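/- arXiv:2512.23651 — 3 statements merged into one kernel-verified Lean document; each statement's English description precedes it below -/
import Mathlib

section
/- Let d ≥ 2 and λ > 0. Suppose that for every d-simplex T in ℝ^d and every weakly non-separable family 𝒯 = {yⱼ + σⱼT : yⱼ ∈ ℝ^d, σⱼ > 0, j = 1, …, m} of positive homothets of T, some translate of λ(Σⱼ₌₁ᵐ σⱼ)T contains ⋃𝒯. Then for every d-polytope P in ℝ^d and every weakly non-separable family 𝒫 = {xᵢ + τᵢP : xᵢ ∈ ℝ^d, τᵢ > 0, i = 1, …, n} of positive homothets of P, some translate of λ(Σᵢ₌₁ⁿ τᵢ)P contains ⋃𝒫. -/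
open Set Metric Pointwise MeasureTheory

noncomputable section

abbrev Euc (d : ℕ) := EuclideanSpace ℝ (Fin d)

variable {d : ℕ}

/-- A convex body: compact, convex, with nonempty interior. -/
def IsConvexBody (K : Set (Euc d)) : Prop :=
  IsCompact K ∧ Convex ℝ K ∧ (interior K).Nonempty

/-- A hyperplane of `ℝ^d`. -/
def IsHyperplane (H : Set (Euc d)) : Prop :=
  ∃ u : Euc d, u ≠ 0 ∧ ∃ c : ℝ, H = {x : Euc d | (inner ℝ x u : ℝ) = c}

/-- A straight line in `ℝ^d`. -/
def IsLine (L : Set (Euc d)) : Prop :=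
  ∃ p v : Euc d, v ≠ 0 ∧ L = {x : Euc d | ∃ t : ℝ, x = p + t • v}

/-- A `d`-polytope: convex hull of finitely many points, with nonempty interior. -/
def IsPolytope (P : Set (Euc d)) : Prop :=
  ∃ S : Finset (Euc d), P = convexHull ℝ (S : Set (Euc d)) ∧ (interior P).Nonempty

/-- A `d`-simplex: convex hull of `d+1` affinely independent points. -/
def IsSimplex (d : ℕ) (T : Set (Euc d)) : Prop :=
  ∃ v : Fin (d + 1) → Euc d, AffineIndependent ℝ v ∧ T = convexHull ℝ (Set.range v)

/-- The exposed face of `P` in direction `u`. -/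
def exposedFaceAt (P : Set (Euc d)) (u : Euc d) : Set (Euc d) :=
  {x ∈ P | ∀ y ∈ P, (inner ℝ y u : ℝ) ≤ (inner ℝ x u : ℝ)}

/-- `u` is the outer unit normal vector of a facet of `P`. -/
def IsFacetNormal (P : Set (Euc d)) (u : Euc d) : Prop :=
  ‖u‖ = 1 ∧ Module.finrank ℝ (affineSpan ℝ (exposedFaceAt P u)).direction = d - 1

/-- The hyperplane `H` is parallel to some facet of `P`:
some translate of `H` contains the facet. -/
def HypParallelToFacet (P H : Set (Euc d)) : Prop :=
  ∃ u : Euc d, IsFacetNormal P u ∧ ∃ v : Euc d, exposedFaceAt P u ⊆ (fun x => v + x) '' H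

/-- The positive homothet `x + τ • P`. -/
def homo (x : Euc d) (τ : ℝ) (P : Set (Euc d)) : Set (Euc d) := {x} + τ • P

/-- A weakly non-separable family of positive homothets of the polytope `P`. -/
def WNS (P : Set (Euc d)) {n : ℕ} (x : Fin n → Euc d) (τ : Fin n → ℝ) : Prop :=
  ∀ H : Set (Euc d), IsHyperplane H → HypParallelToFacet P H →
    (H ∩ convexHull ℝ (⋃ i, homo (x i) (τ i) P)).Nonempty →
    ∃ i, (H ∩ homo (x i) (τ i) P).Nonempty

/-- A non-separable family of convex bodies. -/
def NS {n : ℕ} (F : Fin n → Set (Euc d)) : Prop :=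
  ∀ H : Set (Euc d), IsHyperplane H →
    (H ∩ convexHull ℝ (⋃ i, F i)).Nonempty → ∃ i, (H ∩ F i).Nonempty

/-- `A` is a `k`-dimensional affine subspace of `ℝ^d` (as a set). -/
def IsAffSub (k : ℕ) (A : Set (Euc d)) : Prop :=
  ∃ S : AffineSubspace ℝ (Euc d), (S : Set (Euc d)) = A ∧ A.Nonempty ∧
    Module.finrank ℝ S.direction = k

/-- The affine subspace `A` is parallel to some facet of `P`:
some translate of `A` is contained in the affine hull of the facet. -/
def SubParallelToFacet (P A : Set (Euc d)) : Prop :=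
  ∃ u : Euc d, IsFacetNormal P u ∧ ∃ v : Euc d,
    (fun x => v + x) '' A ⊆ (affineSpan ℝ (exposedFaceAt P u) : Set (Euc d))

/-- A weakly `k`-impassable family of positive homothets of the polytope `P`. -/
def WIP (k : ℕ) (P : Set (Euc d)) {n : ℕ} (x : Fin n → Euc d) (τ : Fin n → ℝ) : Prop :=
  ∀ A : Set (Euc d), IsAffSub k A → SubParallelToFacet P A →
    (A ∩ convexHull ℝ (⋃ i, homo (x i) (τ i) P)).Nonempty →
    ∃ i, (A ∩ homo (x i) (τ i) P).Nonempty

/-- A full-rank lattice in `ℝ^d`. -/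
def IsFullLattice (L : Set (Euc d)) : Prop :=
  ∃ b : Module.Basis (Fin d) ℝ (Euc d),
    L = Set.range fun z : Fin d → ℤ => ∑ i, (z i : ℝ) • b i

/-- The integer lattice `ℤ^d` as a subset of `ℝ^d`. -/
def intLattice (d : ℕ) : Set (Euc d) := {x : Euc d | ∀ i, ∃ z : ℤ, x i = (z : ℝ)}

/-- The unit cube `[0,1]^d`. -/
def unitCube (d : ℕ) : Set (Euc d) := {x : Euc d | ∀ i, x i ∈ Set.Icc (0 : ℝ) 1}

/-- The axis-parallel hyperplane `{x : x_j = c}`. -/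
def axisHyp (d : ℕ) (j : Fin d) (c : ℝ) : Set (Euc d) := {x : Euc d | x j = c}

/-- A weakly non-separable family of translates of the unit cube. -/
def CubeWNS {d n : ℕ} (p : Fin n → Euc d) : Prop :=
  ∀ (j : Fin d) (c : ℝ),
    (axisHyp d j c ∩ convexHull ℝ (⋃ k, {p k} + unitCube d)).Nonempty →
    ∃ k, (axisHyp d j c ∩ ({p k} + unitCube d)).Nonempty


/-- The function `c ↦ max_w (M w - ⟪c, w⟫)` has a minimizer `c`, and at a minimizer the
active vectors contain `0` in their convex hull. -/
theorem exists_minimax_certificate {E : Type} [NormedAddCommGroup E] [InnerProductSpace ℝ E]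
    [FiniteDimensional ℝ E] (W : Finset E) (hW : W.Nonempty) (M : E → ℝ) (δ : ℝ) (hδ : 0 < δ)
    (hcoer : ∀ c : E, ∃ w ∈ W, δ * ‖c‖ ≤ -(inner ℝ c w : ℝ)) :
    ∃ (c : E) (g : ℝ), (∀ w ∈ W, M w - (inner ℝ c w : ℝ) ≤ g) ∧
      ∃ (ι : Type) (_ : Fintype ι) (z : ι → E) (a : ι → ℝ),
        (∀ i, z i ∈ W) ∧ (∀ i, M (z i) - (inner ℝ c (z i) : ℝ) = g) ∧
        AffineIndependent ℝ z ∧ (∀ i, 0 < a i) ∧ ∑ i, a i = 1 ∧ ∑ i, a i • z i = 0 := by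
  set f : E → ℝ := fun c => W.sup' hW (fun w => M w - (inner ℝ c w : ℝ)) with hf
  have hle : ∀ c, ∀ w ∈ W, M w - (inner ℝ c w : ℝ) ≤ f c := fun c w hw =>
    Finset.le_sup' (fun w => M w - (inner ℝ c w : ℝ)) hw
  have hcont : Continuous f := by
    refine Continuous.finset_sup'_apply hW fun w _ => ?_
    fun_prop
  obtain ⟨w₀, -, hw₀⟩ := W.exists_min_image M hW
  obtain ⟨c, hc⟩ : ∃ c, ∀ y, f c ≤ f y := by
    refine hcont.exists_forall_le_of_isBounded 0 ?_
    refine (Metric.isBounded_closedBall (x := (0 : E)) (r := (f 0 - M w₀) / δ)).subset fun c hc => ?_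
    obtain ⟨w, hw, hcw⟩ := hcoer c
    have h1 := hle c w hw
    have h2 := hw₀ w hw
    have h3 : f c ≤ f 0 := hc
    rw [mem_closedBall_zero_iff, le_div_iff₀ hδ]
    linarith
  refine ⟨c, f c, hle c, ?_⟩
  set A : Set E := {w | w ∈ W ∧ M w - (inner ℝ c w : ℝ) = f c} with hA
  have hAfin : A.Finite := W.finite_toSet.subset fun w hw => hw.1
  have h0 : (0 : E) ∈ convexHull ℝ A := by
    by_contra h0
    obtain ⟨φ, u, hu, hφ⟩ := geometric_hahn_banach_point_closed (convex_convexHull ℝ A)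
      (hAfin.isClosed_convexHull ℝ) h0
    rw [map_zero] at hu
    set v : E := (InnerProductSpace.toDual ℝ E).symm φ with hv
    have hvw : ∀ w, (inner ℝ v w : ℝ) = φ w := fun w => by
      rw [hv, InnerProductSpace.toDual_symm_apply]
    have hev : ∀ w ∈ W, ∀ᶠ t : ℝ in nhdsWithin 0 (Ioi 0),
        M w - (inner ℝ (c + t • v) w : ℝ) < f c := by
      intro w hw
      rcases (hle c w hw).lt_or_eq with h | h
      · have hct : Continuous fun t : ℝ => M w - (inner ℝ (c + t • v) w : ℝ) := by fun_prop
        have : Filter.Tendsto (fun t : ℝ => M w - (inner ℝ (c + t • v) w : ℝ)) (nhds 0)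
            (nhds (M w - (inner ℝ c w : ℝ))) := by
          simpa using hct.tendsto 0
        exact (this.eventually_lt_const h).filter_mono nhdsWithin_le_nhds
      · filter_upwards [self_mem_nhdsWithin] with t ht
        have hφw := hφ w (subset_convexHull ℝ A ⟨hw, h⟩)
        rw [inner_add_left, real_inner_smul_left, hvw]
        have : 0 < t * φ w := mul_pos ht (hu.trans hφw)
        linarith
    obtain ⟨t, ht⟩ := ((Filter.eventually_all_finset W).2 hev).exists
    have : f (c + t • v) < f c := (Finset.sup'_lt_iff hW).2 ht
    exact absurd (hc _) (not_le.2 this)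
  obtain ⟨ι, hι, z, a, hz, hind, ha, ha1, haz⟩ := eq_pos_convex_span_of_mem_convexHull h0
  exact ⟨ι, hι, z, a, fun i => (hz ⟨i, rfl⟩).1, fun i => (hz ⟨i, rfl⟩).2, hind, ha, ha1, haz⟩

/-- A full-dimensional polytope is the intersection of finitely many half-spaces whose boundary
hyperplanes are parallel to facets and touch the polytope. -/
theorem IsPolytope.exists_facet_representation (hd : 2 ≤ d) {P : Set (Euc d)} (hP : IsPolytope P) :
    ∃ (p₀ : Euc d) (W : Finset (Euc d)), W.Nonempty ∧
      (∀ z, z ∈ P ↔ ∀ w ∈ W, (inner ℝ (z - p₀) w : ℝ) ≤ 1) ∧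
      ∀ w ∈ W, w ≠ 0 ∧ (∃ p ∈ P, (inner ℝ (p - p₀) w : ℝ) = 1) ∧
        ∀ r : ℝ, HypParallelToFacet P {x | (inner ℝ x w : ℝ) = r} := by
  classical
  obtain ⟨S, rfl, p₀, hp₀⟩ := hP
  set Q : Set (Euc d) := {w | ∀ s ∈ S, (inner ℝ (s - p₀) w : ℝ) ≤ 1} with hQ
  have hQconv : Convex ℝ Q := by
    intro w hw w' hw' a b ha hb hab s hs
    rw [inner_add_right, real_inner_smul_right, real_inner_smul_right]
    nlinarith [hw s hs, hw' s hs]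
  have hQP : ∀ w ∈ Q, ∀ p ∈ convexHull ℝ (S : Set (Euc d)), (inner ℝ (p - p₀) w : ℝ) ≤ 1 := by
    intro w hw p hp
    have hconv : Convex ℝ {p : Euc d | (inner ℝ (p - p₀) w : ℝ) ≤ 1} := by
      intro x hx y hy a b ha hb hab
      simp only [mem_ofPred_eq, inner_sub_left, inner_add_left, real_inner_smul_left] at *
      have : (inner ℝ p₀ w : ℝ) = a * inner ℝ p₀ w + b * inner ℝ p₀ w := by
        rw [← add_mul, hab, one_mul]
      nlinarith
    exact convexHull_min (fun s hs => hw s hs) hconv hp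
  have hQclosed : IsClosed Q := by
    have : Q = ⋂ s ∈ S, {w | (inner ℝ (s - p₀) w : ℝ) ≤ 1} := by ext; simp [hQ]
    rw [this]
    exact isClosed_biInter fun s _ => isClosed_le (by fun_prop) continuous_const
  have hQbdd : Bornology.IsBounded Q := by
    obtain ⟨ε, hε, hball⟩ := Metric.isOpen_iff.1 isOpen_interior p₀ hp₀
    refine (Metric.isBounded_closedBall (x := (0 : Euc d)) (r := 2 / ε)).subset fun w hw => ?_
    rw [mem_closedBall_zero_iff]
    rcases eq_or_ne w 0 with rfl | hw0
    · simp only [norm_zero]; positivity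
    have hwn : 0 < ‖w‖ := norm_pos_iff.2 hw0
    have hmem : p₀ + (ε / 2 / ‖w‖) • w ∈ convexHull ℝ (S : Set (Euc d)) := by
      refine interior_subset (hball ?_)
      rw [mem_ball_iff_norm, add_sub_cancel_left, norm_smul, Real.norm_of_nonneg (by positivity),
        div_mul_cancel₀ _ hwn.ne']
      linarith
    have := hQP w hw _ hmem
    rw [add_sub_cancel_left, real_inner_smul_left, real_inner_self_eq_norm_sq] at this
    have h2 : ε / 2 / ‖w‖ * ‖w‖ ^ 2 = ε * ‖w‖ / 2 := by field_simp
    rw [le_div_iff₀ hε]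
    linarith
  have hQcomp : IsCompact Q := Metric.isCompact_of_isClosed_isBounded hQclosed hQbdd
  -- the constraints active at an extreme point determine it
  set act : Euc d → Finset (Euc d) := fun w => S.filter fun s => (inner ℝ (s - p₀) w : ℝ) = 1
    with hact
  have hext : ∀ w ∈ Q.extremePoints ℝ, ∀ v : Euc d,
      (∀ s ∈ act w, (inner ℝ (s - p₀) v : ℝ) = 0) → v = 0 := by
    intro w hw v hv
    have hev : ∀ᶠ t : ℝ in nhdsWithin 0 (Ioi 0), ∀ s ∈ S,
        (inner ℝ (s - p₀) (w + t • v) : ℝ) ≤ 1 ∧ (inner ℝ (s - p₀) (w - t • v) : ℝ) ≤ 1 := by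
      refine (Filter.eventually_all_finset S).2 fun s hs => ?_
      rcases (hw.1 s hs).lt_or_eq with h | h
      · have h1 : Continuous fun t : ℝ => (inner ℝ (s - p₀) (w + t • v) : ℝ) := by fun_prop
        have h2 : Continuous fun t : ℝ => (inner ℝ (s - p₀) (w - t • v) : ℝ) := by fun_prop
        have h1' := h1.tendsto 0
        have h2' := h2.tendsto 0
        simp only [zero_smul, add_zero, sub_zero] at h1' h2'
        refine Filter.Eventually.filter_mono nhdsWithin_le_nhds ?_
        filter_upwards [h1'.eventually_lt_const h, h2'.eventually_lt_const h] with t a b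
        exact ⟨a.le, b.le⟩
      · refine Filter.Eventually.of_forall fun t => ?_
        have := hv s (Finset.mem_filter.2 ⟨hs, h⟩)
        simp [inner_add_right, inner_sub_right, real_inner_smul_right, this, h]
    obtain ⟨t, ht, ht0⟩ := (hev.and self_mem_nhdsWithin).exists
    have hmid : w ∈ openSegment ℝ (w + t • v) (w - t • v) :=
      ⟨1 / 2, 1 / 2, by norm_num, by norm_num, by norm_num, by module⟩
    have := hw.2 (x₁ := w + t • v) (fun s hs => (ht s hs).1)
      (x₂ := w - t • v) (fun s hs => (ht s hs).2) hmid
    have htv : t • v = 0 := by simpa using this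
    exact (smul_eq_zero.1 htv).resolve_left (ne_of_gt ht0)
  have hfin : (Q.extremePoints ℝ).Finite := by
    refine Set.Finite.of_finite_image (f := act)
      (S.powerset.finite_toSet.subset ?_) fun w hw w' hw' h => ?_
    · rintro _ ⟨w, -, rfl⟩
      exact Finset.mem_coe.2 (Finset.mem_powerset.2 (Finset.filter_subset _ _))
    · refine sub_eq_zero.1 (hext w hw _ fun s hs => ?_)
      have h1 := (Finset.mem_filter.1 hs).2
      have h2 := (Finset.mem_filter.1 (h ▸ hs : s ∈ act w')).2
      rw [inner_sub_right, h1, h2, sub_self]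
  have hnonempty : (Q.extremePoints ℝ).Nonempty :=
    hQcomp.extremePoints_nonempty ⟨0, fun s _ => by simp⟩
  have hspan : ∀ w ∈ Q.extremePoints ℝ,
      Submodule.span ℝ ((fun s => s - p₀) '' (act w : Set (Euc d))) = ⊤ := by
    intro w hw
    rw [← Submodule.orthogonal_eq_bot_iff, Submodule.eq_bot_iff]
    intro v hv
    refine hext w hw v fun s hs => ?_
    exact (Submodule.mem_orthogonal _ _).1 hv _ (Submodule.subset_span ⟨s, hs, rfl⟩)
  have : Nontrivial (Euc d) := by
    have : Nonempty (Fin d) := ⟨⟨0, by omega⟩⟩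
    infer_instance
  have hactne : ∀ w ∈ Q.extremePoints ℝ, (act w).Nonempty := by
    intro w hw
    rw [Finset.nonempty_iff_ne_empty]
    intro h
    have := hspan w hw
    simp [h] at this
  refine ⟨p₀, hfin.toFinset, hfin.toFinset_nonempty.2 hnonempty, fun z => ⟨fun hz w hw => ?_,
    fun hz => ?_⟩, fun w hw => ?_⟩
  · exact hQP w (hfin.mem_toFinset.1 hw).1 z hz
  · have hzQ : ∀ w ∈ Q, (inner ℝ (z - p₀) w : ℝ) ≤ 1 := by
      intro w hw
      rw [← closure_convexHull_extremePoints hQcomp hQconv] at hw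
      have hconv : Convex ℝ {w : Euc d | (inner ℝ (z - p₀) w : ℝ) ≤ 1} := by
        intro x hx y hy a b ha hb hab
        simp only [mem_ofPred_eq, inner_add_right, real_inner_smul_right] at *
        nlinarith
      have hclosed : IsClosed {w : Euc d | (inner ℝ (z - p₀) w : ℝ) ≤ 1} :=
        isClosed_le (by fun_prop) continuous_const
      exact closure_minimal (convexHull_min (fun w hw => hz w (hfin.mem_toFinset.2 hw)) hconv)
        hclosed hw
    by_contra hzP
    obtain ⟨φ, u, hφ, hu⟩ := geometric_hahn_banach_closed_point (convex_convexHull ℝ _)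
      (S.finite_toSet.isClosed_convexHull ℝ) hzP
    set v : Euc d := (InnerProductSpace.toDual ℝ _).symm φ with hv
    have hvw : ∀ x, (inner ℝ x v : ℝ) = φ x := fun x => by
      rw [real_inner_comm, hv, InnerProductSpace.toDual_symm_apply]
    have hpos : 0 < u - φ p₀ := sub_pos.2 (hφ _ (interior_subset hp₀))
    have hval : ∀ x, (inner ℝ (x - p₀) ((u - φ p₀)⁻¹ • v) : ℝ) = (φ x - φ p₀) / (u - φ p₀) := by
      intro x
      rw [real_inner_smul_right, inner_sub_left, hvw, hvw]
      ring
    have h1 := hzQ ((u - φ p₀)⁻¹ • v) fun s hs => by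
      rw [hval, div_le_one hpos]
      linarith [hφ s (subset_convexHull ℝ _ hs)]
    rw [hval, div_le_one hpos] at h1
    linarith
  · rw [hfin.mem_toFinset] at hw
    obtain ⟨s₀, hs₀⟩ := hactne w hw
    have hs₀' := Finset.mem_filter.1 hs₀
    have hw0 : w ≠ 0 := by
      rintro rfl
      simpa using hs₀'.2
    have hwn : 0 < ‖w‖ := norm_pos_iff.2 hw0
    have hsP : ∀ s ∈ act w, s ∈ convexHull ℝ (S : Set (Euc d)) := fun s hs =>
      subset_convexHull ℝ _ (Finset.mem_filter.1 hs).1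
    refine ⟨hw0, ⟨s₀, hsP _ hs₀, hs₀'.2⟩, fun r => ?_⟩
    set F := exposedFaceAt (convexHull ℝ (S : Set (Euc d))) (‖w‖⁻¹ • w) with hF
    have hFval : ∀ x ∈ F, (inner ℝ (x - p₀) w : ℝ) = 1 := by
      intro x hx
      have h1 := hQP w hw.1 x hx.1
      have h2 := hx.2 s₀ (hsP _ hs₀)
      rw [real_inner_smul_right, real_inner_smul_right,
        mul_le_mul_iff_right₀ (inv_pos.2 hwn)] at h2
      have h3 := hs₀'.2
      rw [inner_sub_left] at *
      linarith
    have hactF : ∀ s ∈ act w, s ∈ F := by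
      intro s hs
      refine ⟨hsP s hs, fun y hy => ?_⟩
      have h1 := hQP w hw.1 y hy
      have h3 := (Finset.mem_filter.1 hs).2
      rw [real_inner_smul_right, real_inner_smul_right, mul_le_mul_iff_right₀ (inv_pos.2 hwn)]
      rw [inner_sub_left] at *
      linarith
    refine ⟨‖w‖⁻¹ • w, ⟨by rw [norm_smul, norm_inv, norm_norm, inv_mul_cancel₀ hwn.ne'], ?_⟩,
      ((1 + inner ℝ p₀ w - r) / ‖w‖ ^ 2) • w, ?_⟩
    · rw [← hF, direction_affineSpan]
      have hup : vectorSpan ℝ F ≤ (Submodule.span ℝ {w})ᗮ := by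
        rw [vectorSpan, Submodule.span_le]
        rintro _ ⟨x, hx, y, hy, rfl⟩
        have h1 := hFval x hx
        have h2 := hFval y hy
        rw [inner_sub_left] at h1 h2
        rw [SetLike.mem_coe, Submodule.mem_orthogonal_singleton_iff_inner_left]
        simp only [vsub_eq_sub, inner_sub_left]
        linarith
      have hlow : (⊤ : Submodule ℝ (Euc d)) ≤ vectorSpan ℝ F ⊔ Submodule.span ℝ {s₀ - p₀} := by
        rw [← hspan w hw, Submodule.span_le]
        rintro _ ⟨s, hs, rfl⟩
        have : s - p₀ = (s -ᵥ s₀) + (s₀ - p₀) := by simp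
        simp only
        rw [this]
        exact Submodule.add_mem_sup (vsub_mem_vectorSpan ℝ (hactF s hs) (hactF s₀ hs₀))
          (Submodule.mem_span_singleton_self _)
      have h1 := Submodule.finrank_mono hup
      have h2 := Submodule.finrank_mono hlow
      have h3 := Submodule.finrank_add_le_finrank_add_finrank (vectorSpan ℝ F)
        (Submodule.span ℝ {s₀ - p₀})
      have h4 := finrank_span_le_card (R := ℝ) ({s₀ - p₀} : Set (Euc d))
      have h5 := Submodule.finrank_add_finrank_orthogonal (Submodule.span ℝ {w})
      rw [finrank_span_singleton hw0] at h5
      simp only [finrank_top, finrank_euclideanSpace, Fintype.card_fin, toFinset_singleton,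
        Finset.card_singleton] at *
      omega
    · intro x hx
      refine ⟨x - ((1 + inner ℝ p₀ w - r) / ‖w‖ ^ 2) • w, ?_, by simp⟩
      have h1 := hFval x hx
      rw [inner_sub_left] at h1
      rw [mem_ofPred_eq, inner_sub_left, real_inner_smul_left, real_inner_self_eq_norm_sq,
        div_mul_cancel₀ _ (by positivity)]
      linarith

theorem mem_homo_iff {x z : Euc d} {τ : ℝ} {P : Set (Euc d)} :
    z ∈ homo x τ P ↔ ∃ p ∈ P, x + τ • p = z := by
  simp only [homo, Set.mem_add, Set.mem_smul_set, mem_singleton_iff, exists_eq_left,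
    exists_exists_and_eq_and]

/-- Vectors summing to zero and spanning `ℝ^d` are the facet normals of a simplex with prescribed
support numbers of total sum one. -/
theorem exists_simplex_vertices {κ : Type} [Fintype κ] [DecidableEq κ]
    (hκ : Fintype.card κ = d + 1) (N : κ → Euc d) (hN0 : ∑ k, N k = 0)
    (hN : Submodule.span ℝ (range N) = ⊤) (b : κ → ℝ) (hb : ∑ k, b k = 1) :
    ∃ v : κ → Euc d, AffineIndependent ℝ v ∧
      ∀ k l, (inner ℝ (v k) (N l) : ℝ) = b l - if k = l then 1 else 0 := by
  let Φ : Euc d →ₗ[ℝ] (κ → ℝ) := LinearMap.pi fun l => (innerₗ (Euc d)).flip (N l)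
  have hΦ : ∀ x l, Φ x l = (inner ℝ x (N l) : ℝ) := fun x l => rfl
  let tot : (κ → ℝ) →ₗ[ℝ] ℝ := ∑ k, LinearMap.proj k
  have htot : ∀ f, tot f = ∑ k, f k := fun f => by simp [tot]
  have hinj : LinearMap.ker Φ = ⊥ := by
    rw [Submodule.eq_bot_iff]
    intro x hx
    have hx' : x ∈ (Submodule.span ℝ (range N))ᗮ := by
      rw [Submodule.mem_orthogonal']
      intro u hu
      induction hu using Submodule.span_induction with
      | mem u hu =>
        obtain ⟨l, rfl⟩ := hu
        rw [← hΦ, LinearMap.mem_ker.1 hx, Pi.zero_apply]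
      | zero => simp
      | add u u' _ _ h h' => rw [inner_add_right, h, h', add_zero]
      | smul c u _ h => rw [real_inner_smul_right, h, mul_zero]
    simpa [hN] using hx'
  have hle : LinearMap.range Φ ≤ LinearMap.ker tot := by
    rintro _ ⟨x, rfl⟩
    rw [LinearMap.mem_ker, htot]
    simp only [hΦ]
    rw [← inner_sum, hN0, inner_zero_right]
  have hsurj : LinearMap.range tot = ⊤ := by
    rw [LinearMap.range_eq_top]
    intro t
    exact ⟨t • b, by rw [map_smul, htot, hb, smul_eq_mul, mul_one]⟩
  have heq : LinearMap.range Φ = LinearMap.ker tot := by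
    refine Submodule.eq_of_le_of_finrank_eq hle ?_
    have h1 := Φ.finrank_range_add_finrank_ker
    have h2 := tot.finrank_range_add_finrank_ker
    rw [hinj, finrank_bot] at h1
    rw [hsurj, finrank_top, Module.finrank_self, Module.finrank_fintype_fun_eq_card, hκ] at h2
    rw [finrank_euclideanSpace, Fintype.card_fin] at h1
    omega
  have hex : ∀ k, ∃ x, Φ x = fun l => b l - if k = l then 1 else 0 := by
    intro k
    have : (fun l => b l - if k = l then (1 : ℝ) else 0) ∈ LinearMap.range Φ := by
      rw [heq, LinearMap.mem_ker, htot]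
      simp [Finset.sum_sub_distrib, hb]
    exact this
  choose v hv using hex
  have hv' : ∀ k l, (inner ℝ (v k) (N l) : ℝ) = b l - if k = l then 1 else 0 := fun k l => by
    rw [← hΦ, hv]
  refine ⟨v, ?_, hv'⟩
  rw [affineIndependent_iff]
  intro s m hm0 hm l hl
  have h := congrArg (fun x => (inner ℝ x (N l) : ℝ)) hm
  simp only [sum_inner, real_inner_smul_left, hv', inner_zero_left, mul_sub,
    Finset.sum_sub_distrib, ← Finset.sum_mul, hm0] at h
  simpa [hl] using h

/-- A family of homothets of a simplex is weakly non-separable as soon as its projections along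
each facet normal cover an interval. -/
theorem wns_simplex_of_ordConnected (hd : 2 ≤ d) {κ : Type} [Fintype κ] [DecidableEq κ]
    (hκ : Fintype.card κ = d + 1) (N : κ → Euc d) (hN0 : ∑ k, N k = 0)
    (hN : Submodule.span ℝ (range N) = ⊤) (b : κ → ℝ) (v : κ → Euc d)
    (hv : ∀ k l, (inner ℝ (v k) (N l) : ℝ) = b l - if k = l then 1 else 0)
    {m : ℕ} (y : Fin m → Euc d) (σ : Fin m → ℝ) (hσ : ∀ j, 0 < σ j)
    (hconn : ∀ l, (⋃ j, Icc ((inner ℝ (y j) (N l) : ℝ) + σ j * (b l - 1))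
      ((inner ℝ (y j) (N l) : ℝ) + σ j * b l)).OrdConnected) :
    WNS (convexHull ℝ (range v)) y σ := by
  rintro H ⟨u, hu, c, rfl⟩ ⟨w, ⟨-, hw⟩, t, ht⟩ ⟨p, hpH, hp⟩
  set F := exposedFaceAt (convexHull ℝ (range v)) w with hF
  -- all vertices but one lie on the facet
  obtain ⟨l, hl⟩ : ∃ l, ∀ k, k ≠ l → v k ∈ F := by
    classical
    set K : Finset κ := Finset.univ.filter fun k => v k ∈ F with hK
    have hFne : F.Nonempty := by
      rw [nonempty_iff_ne_empty]
      intro h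
      rw [h, direction_affineSpan, vectorSpan_empty, finrank_bot] at hw
      omega
    have hsub : F ⊆ convexHull ℝ (K.image v : Set (Euc d)) := by
      intro x hx
      obtain ⟨κ', _, a, z, ha0, ha1, hz, hax⟩ := mem_convexHull_iff_exists_fintype.1 hx.1
      have hle : ∀ i, (inner ℝ (z i) w : ℝ) ≤ inner ℝ x w := fun i =>
        hx.2 _ (subset_convexHull ℝ _ (hz i))
      have hsum : ∑ i, a i * ((inner ℝ x w : ℝ) - inner ℝ (z i) w) = 0 := by
        have h := congrArg (fun x => (inner ℝ x w : ℝ)) hax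
        simp only [sum_inner, real_inner_smul_left] at h
        simp only [mul_sub, Finset.sum_sub_distrib, ← Finset.sum_mul, ha1, h, one_mul, sub_self]
      have hmem : ∀ i, a i ≠ 0 → z i ∈ (K.image v : Set (Euc d)) := by
        intro i hi
        have h := (Finset.sum_eq_zero_iff_of_nonneg fun i _ =>
          mul_nonneg (ha0 i) (sub_nonneg.2 (hle i))).1 hsum i (Finset.mem_univ _)
        have h' := (mul_eq_zero.1 h).resolve_left hi
        obtain ⟨k, hk⟩ := hz i
        refine Finset.mem_coe.2 (Finset.mem_image.2 ⟨k, Finset.mem_filter.2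
          ⟨Finset.mem_univ _, ?_⟩, hk⟩)
        rw [hk]
        exact ⟨subset_convexHull ℝ _ (hz i), fun y hy => by linarith [hx.2 y hy]⟩
      rw [← hax, ← Finset.sum_filter_of_ne (p := fun i => a i ≠ 0) fun i _ h h' => h (by
        rw [h', zero_smul])]
      refine (convex_convexHull ℝ _).sum_mem (fun i _ => ha0 i) ?_ fun i hi =>
        subset_convexHull ℝ _ (hmem i (Finset.mem_filter.1 hi).2)
      rw [Finset.sum_filter_of_ne fun i _ h => h, ha1]
    have hKne : K.Nonempty := by
      rw [Finset.nonempty_iff_ne_empty]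
      intro h
      obtain ⟨x, hx⟩ := hFne
      simpa [h] using hsub hx
    have hcard : d ≤ K.card := by
      obtain ⟨n, hn⟩ := Nat.exists_eq_succ_of_ne_zero hKne.card_pos.ne'
      have h1 := finrank_vectorSpan_image_finset_le ℝ v K hn
      have h2 : affineSpan ℝ F ≤ affineSpan ℝ (K.image v : Set (Euc d)) := by
        rw [affineSpan_le]
        exact hsub.trans (convexHull_subset_affineSpan _)
      have h3 := Submodule.finrank_mono (AffineSubspace.direction_le h2)
      rw [hw, direction_affineSpan] at h3
      omega
    have hcompl : Kᶜ.card ≤ 1 := by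
      rw [Finset.card_compl, hκ]
      omega
    have hmem : ∀ k, k ∉ Kᶜ → v k ∈ F := fun k hk => by
      simpa [hK] using hk
    rcases Kᶜ.eq_empty_or_nonempty with h | ⟨l, hl⟩
    · have : Nonempty κ := Fintype.card_pos_iff.1 (by omega)
      exact ⟨Classical.arbitrary κ, fun k _ => hmem k (by simp [h])⟩
    · exact ⟨l, fun k hk => hmem k fun hk' => hk (Finset.card_le_one.1 hcompl k hk' l hl)⟩
  have hγ : ∀ k, k ≠ l → (inner ℝ (v k) u : ℝ) = inner ℝ t u + c := by
    intro k hk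
    obtain ⟨q, hq, hqk⟩ := ht (hl k hk)
    have hq' : (inner ℝ q u : ℝ) = c := hq
    rw [← hqk, inner_add_left, hq']
  obtain ⟨ρ, hρ⟩ : ∃ ρ : ℝ, u = ρ • N l := by
    have : u ∈ Submodule.span ℝ (range N) := by rw [hN]; trivial
    obtain ⟨a, ha⟩ := (Submodule.mem_span_range_iff_exists_fun ℝ).1 this
    have hval : ∀ k, (inner ℝ (v k) u : ℝ) = ∑ i, a i * b i - a k := by
      intro k
      rw [← ha, inner_sum]
      simp [real_inner_smul_right, hv, mul_sub, Finset.sum_sub_distrib]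
    set e := ∑ i, a i * b i - (inner ℝ t u + c) with he
    have hae : ∀ k, k ≠ l → a k = e := fun k hk => by linarith [hval k, hγ k hk]
    refine ⟨a l - e, ?_⟩
    have h1 : ∑ k, (a k - e) • N k = u := by
      simp only [sub_smul, Finset.sum_sub_distrib, ha, ← Finset.smul_sum, hN0, smul_zero, sub_zero]
    rw [← h1]
    exact Finset.sum_eq_single l (fun k _ hk => by rw [hae k hk, sub_self, zero_smul]) (by simp)
  have hρ0 : ρ ≠ 0 := fun h => hu (by rw [hρ, h, zero_smul])
  have hrange : ∀ q ∈ convexHull ℝ (range v), b l - 1 ≤ (inner ℝ q (N l) : ℝ) ∧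
      (inner ℝ q (N l) : ℝ) ≤ b l := by
    intro q hq
    have hconv : Convex ℝ ((innerₗ (Euc d)).flip (N l) ⁻¹' Icc (b l - 1) (b l)) :=
      (convex_Icc _ _).linear_preimage _
    refine convexHull_min ?_ hconv hq
    rintro _ ⟨k, rfl⟩
    change (inner ℝ (v k) (N l) : ℝ) ∈ Icc (b l - 1) (b l)
    rw [hv]
    split_ifs <;> constructor <;> linarith
  have hpmem : (inner ℝ p (N l) : ℝ) ∈ ⋃ j, Icc ((inner ℝ (y j) (N l) : ℝ) + σ j * (b l - 1))
      ((inner ℝ (y j) (N l) : ℝ) + σ j * b l) := by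
    have hconv := ((hconn l).convex (𝕜 := ℝ)).linear_preimage ((innerₗ (Euc d)).flip (N l))
    refine convexHull_min ?_ hconv hp
    refine iUnion_subset fun j z hz => ?_
    obtain ⟨q, hq, rfl⟩ := mem_homo_iff.1 hz
    refine mem_iUnion.2 ⟨j, ?_⟩
    change (inner ℝ (y j + σ j • q) (N l) : ℝ) ∈ _
    rw [inner_add_left, real_inner_smul_left]
    have := hrange q hq
    exact ⟨by nlinarith [hσ j], by nlinarith [hσ j]⟩
  obtain ⟨j, hj⟩ := mem_iUnion.1 hpmem
  obtain ⟨k, hk⟩ : ∃ k, k ≠ l := by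
    have : Nontrivial κ := Fintype.one_lt_card_iff_nontrivial.1 (by omega)
    exact exists_ne l
  set s : ℝ := b l - ((inner ℝ p (N l) : ℝ) - inner ℝ (y j) (N l)) / σ j with hs
  have hs0 : 0 ≤ s := by
    rw [hs, sub_nonneg, div_le_iff₀ (hσ j)]
    linarith [hj.2]
  have hs1 : s ≤ 1 := by
    rw [hs, sub_le_comm, le_div_iff₀ (hσ j)]
    linarith [hj.1]
  refine ⟨j, y j + σ j • (s • v l + (1 - s) • v k), ?_, mem_homo_iff.2 ⟨_, ?_, rfl⟩⟩
  · have hpc : (inner ℝ p u : ℝ) = c := hpH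
    change (inner ℝ _ u : ℝ) = c
    rw [← hpc, hρ]
    simp only [real_inner_smul_right, inner_add_left, real_inner_smul_left, hv, if_true, hk,
      if_false]
    have : σ j * (b l - s) = (inner ℝ p (N l) : ℝ) - inner ℝ (y j) (N l) := by
      rw [hs, sub_sub_cancel, mul_div_cancel₀ _ (hσ j).ne']
    linear_combination ρ * this
  · exact convex_convexHull ℝ _ (subset_convexHull ℝ _ (mem_range_self l))
      (subset_convexHull ℝ _ (mem_range_self k)) hs0 (by linarith) (by ring)

/-- Along a facet normal `w` the projections of a weakly non-separable family cover an interval,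
also after enlarging each projection downwards. -/
theorem WNS.ordConnected {P : Set (Euc d)} {n : ℕ} {x : Fin n → Euc d} {τ : Fin n → ℝ}
    (hτ : ∀ i, 0 < τ i) (hwns : WNS P x τ) {p₀ w p : Euc d} (hw : w ≠ 0) (hp : p ∈ P)
    (hpw : (inner ℝ (p - p₀) w : ℝ) = 1) (hle : ∀ q ∈ P, (inner ℝ (q - p₀) w : ℝ) ≤ 1)
    (hpar : ∀ r : ℝ, HypParallelToFacet P {x | (inner ℝ x w : ℝ) = r}) {a : ℝ} (ha : 0 < a)
    (hlow : ∀ q ∈ P, a - 1 ≤ a * (inner ℝ (q - p₀) w : ℝ)) :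
    (⋃ j, Icc (a * (inner ℝ (x j + τ j • p₀) w : ℝ) + τ j * (a - 1))
      (a * (inner ℝ (x j + τ j • p₀) w : ℝ) + τ j * a)).OrdConnected := by
  have hval : ∀ j q, a * (inner ℝ (x j + τ j • q) w : ℝ) =
      a * (inner ℝ (x j + τ j • p₀) w : ℝ) + τ j * (a * (inner ℝ (q - p₀) w : ℝ)) := by
    intro j q
    simp only [inner_add_left, real_inner_smul_left, inner_sub_left]
    ring
  have hmem : ∀ j, x j + τ j • p ∈ convexHull ℝ (⋃ i, homo (x i) (τ i) P) := fun j =>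
    subset_convexHull ℝ _ (mem_iUnion.2 ⟨j, mem_homo_iff.2 ⟨p, hp, rfl⟩⟩)
  refine ⟨fun s hs t ht r hr => ?_⟩
  by_contra hnot
  rw [mem_iUnion] at hs ht hnot
  push Not at hnot
  obtain ⟨i, hi⟩ := hs
  obtain ⟨j, hj⟩ := ht
  have hir : a * (inner ℝ (x i + τ i • p) w : ℝ) < r := by
    rw [hval, hpw, mul_one]
    by_contra h
    exact hnot i ⟨hi.1.trans hr.1, not_lt.1 h⟩
  have hjr : r < a * (inner ℝ (x j + τ j • p) w : ℝ) := by
    have h1 : r < a * (inner ℝ (x j + τ j • p₀) w : ℝ) + τ j * (a - 1) := by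
      by_contra h
      exact hnot j ⟨not_lt.1 h, hr.2.trans hj.2⟩
    rw [hval, hpw]
    linarith [hτ j]
  obtain ⟨k, q, hqr, hq⟩ := hwns {x | (inner ℝ x w : ℝ) = r / a} ⟨w, hw, r / a, rfl⟩ (hpar _) (by
    have hconv : Convex ℝ ((innerₗ (Euc d)).flip w ''
        convexHull ℝ (⋃ i, homo (x i) (τ i) P)) :=
      (convex_convexHull ℝ _).linear_image _
    obtain ⟨z, hz, hzr⟩ := hconv.ordConnected.out (mem_image_of_mem _ (hmem i))
      (mem_image_of_mem _ (hmem j)) (show r / a ∈ _ from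
        ⟨(le_div_iff₀' ha).2 hir.le, (div_le_iff₀' ha).2 hjr.le⟩)
    exact ⟨z, hzr, hz⟩)
  obtain ⟨q, hqP, rfl⟩ := mem_homo_iff.1 hq
  have hr' : a * (inner ℝ (x k + τ k • q) w : ℝ) = r := by
    have : (inner ℝ (x k + τ k • q) w : ℝ) = r / a := hqr
    rw [this, mul_div_cancel₀ _ ha.ne']
  rw [hval] at hr'
  have h1 := hlow q hqP
  have h2 := hle q hqP
  refine hnot k ⟨?_, ?_⟩
  · nlinarith [hτ k]
  · nlinarith [hτ k, mul_le_mul_of_nonneg_left h2 ha.le]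

/-- The covering bound for simplices, transferred to the cylinder over a simplex given by
positively dependent, affinely independent facet normals `z i`. -/
theorem exists_center_of_simplex_bound (hd : 2 ≤ d) {lam : ℝ}
    (hsimp : ∀ T : Set (Euc d), IsSimplex d T →
      ∀ (m : ℕ) (y : Fin m → Euc d) (σ : Fin m → ℝ), (∀ j, 0 < σ j) →
      WNS T y σ →
      ∃ c : Euc d, (⋃ j, homo (y j) (σ j) T) ⊆ homo c (lam * ∑ j, σ j) T)
    (hlam : 0 < lam) {ι : Type} [Fintype ι] (z : ι → Euc d) (a : ι → ℝ)
    (hz : AffineIndependent ℝ z) (hz0 : ∀ i, z i ≠ 0) (ha : ∀ i, 0 < a i) (ha1 : ∑ i, a i = 1)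
    (haz : ∑ i, a i • z i = 0) {n : ℕ} (x : Fin n → Euc d) (τ : Fin n → ℝ) (hτ : ∀ j, 0 < τ j)
    (hconn : ∀ i, (⋃ j, Icc (a i * (inner ℝ (x j) (z i) : ℝ) + τ j * (a i - 1))
      (a i * (inner ℝ (x j) (z i) : ℝ) + τ j * a i)).OrdConnected) :
    ∃ c : Euc d, ∀ i j, (inner ℝ (x j) (z i) : ℝ) + τ j ≤
      (inner ℝ c (z i) : ℝ) + lam * ∑ j, τ j := by
  classical
  have hne : Nonempty ι := by
    by_contra h
    rw [not_nonempty_iff] at h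
    simp at ha1
  have hnt : Nontrivial ι := by
    by_contra h
    rw [not_nontrivial_iff_subsingleton] at h
    have i := Classical.arbitrary ι
    rw [Fintype.sum_subsingleton _ i] at haz
    exact hz0 i ((smul_eq_zero.1 haz).resolve_left (ha i).ne')
  set V : Submodule ℝ (Euc d) := Submodule.span ℝ (range z) with hV
  have hzV : ∀ i, z i ∈ V := fun i => Submodule.subset_span (mem_range_self i)
  have hVspan : V = vectorSpan ℝ (range z) := by
    refine le_antisymm ?_ ?_
    · rw [hV, Submodule.span_le]
      rintro _ ⟨i, rfl⟩
      have : z i = ∑ k, a k • (z i -ᵥ z k) := by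
        simp only [vsub_eq_sub, smul_sub, Finset.sum_sub_distrib, ← Finset.sum_smul, ha1, haz,
          one_smul, sub_zero]
      rw [this]
      exact Submodule.sum_mem _ fun k _ => Submodule.smul_mem _ _
        (vsub_mem_vectorSpan ℝ (mem_range_self i) (mem_range_self k))
    · rw [vectorSpan, Submodule.span_le]
      rintro _ ⟨_, ⟨i, rfl⟩, _, ⟨k, rfl⟩, rfl⟩
      exact V.sub_mem (hzV i) (hzV k)
  have hVrank : Module.finrank ℝ V + 1 = Fintype.card ι := by
    rw [hVspan]
    exact hz.finrank_vectorSpan_add_one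
  set e := Module.finBasis ℝ Vᗮ with he
  have hcard : Fintype.card (ι ⊕ Fin (Module.finrank ℝ Vᗮ)) = d + 1 := by
    have := V.finrank_add_finrank_orthogonal
    rw [finrank_euclideanSpace, Fintype.card_fin] at this
    rw [Fintype.card_sum, Fintype.card_fin]
    omega
  obtain ⟨i₀⟩ := hne
  set N : ι ⊕ Fin (Module.finrank ℝ Vᗮ) → Euc d :=
    Sum.elim (fun i => a i • z i + if i = i₀ then ∑ k, (e k : Euc d) else 0)
      (fun k => -(e k : Euc d)) with hN
  set b : ι ⊕ Fin (Module.finrank ℝ Vᗮ) → ℝ := Sum.elim a (fun _ => 0) with hb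
  have hNsum : ∑ k, N k = 0 := by
    simp [hN, Finset.sum_add_distrib, haz]
  have hbsum : ∑ k, b k = 1 := by simp [hb, ha1]
  have hNspan : Submodule.span ℝ (range N) = ⊤ := by
    have heN : ∀ k, (e k : Euc d) ∈ Submodule.span ℝ (range N) := fun k => by
      rw [← neg_neg (e k : Euc d)]
      exact Submodule.neg_mem _ (Submodule.subset_span ⟨Sum.inr k, rfl⟩)
    have hzN : ∀ i, z i ∈ Submodule.span ℝ (range N) := fun i => by
      have h1 : N (Sum.inl i) ∈ Submodule.span ℝ (range N) :=
        Submodule.subset_span (mem_range_self _)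
      have h2 : (if i = i₀ then ∑ k, (e k : Euc d) else 0) ∈ Submodule.span ℝ (range N) := by
        split_ifs
        · exact Submodule.sum_mem _ fun k _ => heN k
        · exact Submodule.zero_mem _
      have h3 := Submodule.smul_mem _ (a i)⁻¹ (Submodule.sub_mem _ h1 h2)
      simpa [hN, smul_smul, inv_mul_cancel₀ (ha i).ne'] using h3
    rw [eq_top_iff, ← V.sup_orthogonal_of_hasOrthogonalProjection]
    refine sup_le (Submodule.span_le.2 ?_) fun q hq => ?_
    · rintro _ ⟨i, rfl⟩
      exact hzN i
    · have h := congrArg Subtype.val (e.sum_repr ⟨q, hq⟩)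
      simp only [Submodule.coe_sum, Submodule.coe_smul] at h
      rw [← h]
      exact Submodule.sum_mem _ fun k _ => Submodule.smul_mem _ _ (heN k)
  obtain ⟨v, hvind, hv⟩ := exists_simplex_vertices hcard N hNsum hNspan b hbsum
  set y : Fin n → Euc d := fun j => V.starProjection (x j) with hy
  have hyz : ∀ j i, (inner ℝ (y j) (z i) : ℝ) = inner ℝ (x j) (z i) := fun j i => by
    have := V.starProjection_inner_eq_zero (x j) (z i) (hzV i)
    rw [inner_sub_left] at this
    linarith
  have hye : ∀ j k, (inner ℝ (y j) (e k : Euc d) : ℝ) = 0 := fun j k =>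
    (Submodule.mem_orthogonal _ _).1 (e k).2 _ (V.starProjection_apply_mem _)
  have hyl : ∀ j i, (inner ℝ (y j) (N (Sum.inl i)) : ℝ) = a i * inner ℝ (x j) (z i) := by
    intro j i
    have h : (inner ℝ (y j) (if i = i₀ then ∑ k, (e k : Euc d) else 0) : ℝ) = 0 := by
      split_ifs
      · rw [inner_sum]
        exact Finset.sum_eq_zero fun k _ => hye j k
      · exact inner_zero_right _
    simp only [hN, Sum.elim_inl]
    rw [inner_add_right, h, real_inner_smul_right, hyz, add_zero]
  have hyr : ∀ j k, (inner ℝ (y j) (N (Sum.inr k)) : ℝ) = 0 := by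
    intro j k
    simp [hN, inner_neg_right, hye]
  have hwns : WNS (convexHull ℝ (range v)) y τ := by
    refine wns_simplex_of_ordConnected hd hcard N hNsum hNspan b v hv y τ hτ ?_
    rintro (i | k)
    · simpa only [hyl, hb, Sum.elim_inl] using hconn i
    · simp only [hyr, hb, Sum.elim_inr]
      refine ⟨fun s hs t ht r hr => ?_⟩
      obtain ⟨i, hi⟩ := mem_iUnion.1 hs
      obtain ⟨j, hj⟩ := mem_iUnion.1 ht
      exact mem_iUnion.2 ⟨i, hi.1.trans hr.1, by linarith [hr.2, hj.2]⟩
  have hT : IsSimplex d (convexHull ℝ (range v)) := by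
    let f := Fintype.equivFinOfCardEq hcard
    refine ⟨v ∘ f.symm, hvind.comp_embedding f.symm.toEmbedding, ?_⟩
    rw [f.symm.surjective.range_comp]
  obtain ⟨c, hc⟩ := hsimp _ hT n y τ hτ hwns
  have hzN : ∀ i q, a i * (inner ℝ q (z i) : ℝ) = (inner ℝ q (N (Sum.inl i)) : ℝ) +
      if i = i₀ then ∑ k, (inner ℝ q (N (Sum.inr k)) : ℝ) else 0 := by
    intro i q
    simp only [hN, Sum.elim_inl, Sum.elim_inr]
    split_ifs <;>
    simp [inner_add_right, real_inner_smul_right, inner_sum, inner_neg_right]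
  have hTz : ∀ i, ∀ q ∈ convexHull ℝ (range v), (inner ℝ q (z i) : ℝ) ≤ 1 := by
    intro i q hq
    have hconv : Convex ℝ {q : Euc d | (inner ℝ q (z i) : ℝ) ≤ 1} :=
      (convex_Iic (1 : ℝ)).linear_preimage ((innerₗ (Euc d)).flip (z i))
    refine convexHull_min ?_ hconv hq
    rintro _ ⟨k, rfl⟩
    have h := hzN i (v k)
    simp only [hv, hb, Sum.elim_inl, Sum.elim_inr] at h
    have h2 : a i * (inner ℝ (v k) (z i) : ℝ) ≤ a i := by
      have h3 : ∑ l, ((0 : ℝ) - if k = Sum.inr l then 1 else 0) ≤ 0 :=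
        Finset.sum_nonpos fun l _ => by split_ifs <;> norm_num
      rw [h]
      split_ifs at h3 ⊢ <;> linarith
    exact le_of_mul_le_mul_left (by linarith) (ha i)
  refine ⟨c, fun i j => ?_⟩
  obtain ⟨k, hk⟩ := exists_ne i
  have hvk : (inner ℝ (v (Sum.inl k)) (z i) : ℝ) = 1 := by
    have h : a i * (inner ℝ (v (Sum.inl k)) (z i) : ℝ) = a i := by
      simpa [hv, hb, hk] using hzN i (v (Sum.inl k))
    exact mul_left_cancel₀ (ha i).ne' (h.trans (mul_one _).symm)
  obtain ⟨q, hq, hqe⟩ := mem_homo_iff.1 (hc (mem_iUnion.2 ⟨j, mem_homo_iff.2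
    ⟨v (Sum.inl k), subset_convexHull ℝ _ (mem_range_self _), rfl⟩⟩))
  have h := congrArg (fun q => (inner ℝ q (z i) : ℝ)) hqe
  simp only [inner_add_left, real_inner_smul_left, hyz, hvk, mul_one] at h
  have hpos : 0 ≤ lam * ∑ j, τ j := mul_nonneg hlam.le (Finset.sum_nonneg fun j _ => (hτ j).le)
  nlinarith [hTz i q hq]

/-- a covering bound for WNS-families of simplices transfers to
WNS-families of arbitrary d-polytopes. -/
theorem stmt_7 (d : ℕ) (hd : 2 ≤ d) (lam : ℝ) (hlam : 0 < lam)
    (hsimp : ∀ T : Set (Euc d), IsSimplex d T →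
      ∀ (m : ℕ) (y : Fin m → Euc d) (σ : Fin m → ℝ), (∀ j, 0 < σ j) →
      WNS T y σ →
      ∃ c : Euc d, (⋃ j, homo (y j) (σ j) T) ⊆ homo c (lam * ∑ j, σ j) T) :
    ∀ P : Set (Euc d), IsPolytope P →
      ∀ (n : ℕ) (x : Fin n → Euc d) (τ : Fin n → ℝ), (∀ i, 0 < τ i) →
      WNS P x τ →
      ∃ c : Euc d, (⋃ i, homo (x i) (τ i) P) ⊆ homo c (lam * ∑ i, τ i) P := by
  intro P hP n x τ hτ hwns
  rcases Nat.eq_zero_or_pos n with rfl | hn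
  · exact ⟨0, by simp⟩
  have : Nonempty (Fin n) := ⟨⟨0, hn⟩⟩
  obtain ⟨p₀, W, hWne, hPW, hW⟩ := hP.exists_facet_representation hd
  have hPbdd : Bornology.IsBounded P := by
    obtain ⟨S, rfl, -⟩ := hP
    exact isBounded_convexHull.2 S.finite_toSet.isBounded
  obtain ⟨R, hR, hPR⟩ : ∃ R : ℝ, 0 < R ∧ ∀ p ∈ P, ‖p - p₀‖ < R := by
    obtain ⟨R, hR, hsub⟩ := hPbdd.subset_ball_lt 0 p₀
    exact ⟨R, hR, fun p hp => by simpa [dist_eq_norm] using hsub hp⟩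
  have hcoer : ∀ c : Euc d, ∃ w ∈ W, R⁻¹ * ‖c‖ ≤ -(inner ℝ c w : ℝ) := by
    intro c
    rcases eq_or_ne c 0 with rfl | hc
    · obtain ⟨w, hw⟩ := hWne
      exact ⟨w, hw, by simp⟩
    have hcn : 0 < ‖c‖ := norm_pos_iff.2 hc
    have hnot : p₀ - (R / ‖c‖) • c ∉ P := fun h => by
      have := hPR _ h
      rw [sub_sub_cancel_left, norm_neg, norm_smul, Real.norm_of_nonneg (by positivity),
        div_mul_cancel₀ _ hcn.ne'] at this
      exact lt_irrefl _ this
    rw [hPW] at hnot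
    push Not at hnot
    obtain ⟨w, hw, hlt⟩ := hnot
    refine ⟨w, hw, ?_⟩
    rw [sub_sub_cancel_left, inner_neg_left, real_inner_smul_left, ← mul_neg, div_mul_eq_mul_div,
      lt_div_iff₀ hcn] at hlt
    rw [inv_mul_le_iff₀ hR]
    linarith
  set M : Euc d → ℝ := fun w =>
    Finset.univ.sup' Finset.univ_nonempty fun j => (inner ℝ (x j + τ j • p₀) w : ℝ) + τ j with hM
  obtain ⟨c, g, hg, ι, _, z, a, hzW, hact, hind, ha, ha1, haz⟩ :=
    exists_minimax_certificate W hWne M R⁻¹ (inv_pos.2 hR) hcoer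
  have hlow : ∀ i, ∀ q ∈ P, a i - 1 ≤ a i * (inner ℝ (q - p₀) (z i) : ℝ) := by
    classical
    intro i q hq
    have h0 : ∑ k, a k * (inner ℝ (q - p₀) (z k) : ℝ) = 0 := by
      simp only [← real_inner_smul_right, ← inner_sum, haz, inner_zero_right]
    have h1 : ∑ k ∈ Finset.univ.erase i, a k * (inner ℝ (q - p₀) (z k) : ℝ) ≤
        ∑ k ∈ Finset.univ.erase i, a k := Finset.sum_le_sum fun k _ =>
      mul_le_of_le_one_right (ha k).le ((hPW q).1 hq _ (hzW k))
    rw [← Finset.add_sum_erase _ _ (Finset.mem_univ i)] at h0 ha1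
    linarith
  obtain ⟨c', hc'⟩ := exists_center_of_simplex_bound hd hsimp hlam z a hind
    (fun i => (hW _ (hzW i)).1) ha ha1 haz (fun j => x j + τ j • p₀) τ hτ fun i => by
      obtain ⟨hzi, ⟨p, hp, hpw⟩, hpar⟩ := hW _ (hzW i)
      exact hwns.ordConnected hτ hzi hp hpw (fun q hq => (hPW q).1 hq _ (hzW i)) hpar (ha i)
        (hlow i)
  have hpair : ∀ q : Euc d, ∑ i, a i * (inner ℝ q (z i) : ℝ) = 0 := fun q => by
    simp only [← real_inner_smul_right, ← inner_sum, haz, inner_zero_right]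
  have hgle : g ≤ lam * ∑ j, τ j := by
    have hMle : ∀ i, M (z i) ≤ (inner ℝ c' (z i) : ℝ) + lam * ∑ j, τ j := fun i =>
      Finset.sup'_le _ _ fun j _ => hc' i j
    have h1 : ∑ i, a i * (g + inner ℝ c (z i)) ≤
        ∑ i, a i * ((inner ℝ c' (z i) : ℝ) + lam * ∑ j, τ j) :=
      Finset.sum_le_sum fun i _ => mul_le_mul_of_nonneg_left
        (by linarith [hMle i, hact i]) (ha i).le
    simpa only [mul_add, Finset.sum_add_distrib, hpair, ← Finset.sum_mul, ha1, one_mul, add_zero,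
      zero_add] using h1
  have hpos : 0 < lam * ∑ j, τ j :=
    mul_pos hlam (Finset.sum_pos (fun j _ => hτ j) Finset.univ_nonempty)
  set Λ := lam * ∑ j, τ j with hΛ
  refine ⟨c - Λ • p₀, iUnion_subset fun j y hy => ?_⟩
  obtain ⟨q, hq, rfl⟩ := mem_homo_iff.1 hy
  refine mem_homo_iff.2 ⟨p₀ + Λ⁻¹ • (x j + τ j • q - c), (hPW _).2 fun w hw => ?_, ?_⟩
  · rw [add_sub_cancel_left, real_inner_smul_left, inv_mul_le_iff₀ hpos, mul_one]
    have h1 := hg w hw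
    have h2 : (inner ℝ (x j + τ j • p₀) w : ℝ) + τ j ≤ M w :=
      Finset.le_sup' (fun j => (inner ℝ (x j + τ j • p₀) w : ℝ) + τ j) (Finset.mem_univ j)
    have h3 := (hPW q).1 hq w hw
    simp only [inner_add_left, real_inner_smul_left, inner_sub_left] at *
    nlinarith [mul_le_mul_of_nonneg_left h3 (hτ j).le]
  · rw [smul_add, smul_smul, mul_inv_cancel₀ hpos.ne', one_smul]
    abel

end
end

section
/- Let d ≥ 2 and λ > 0. Suppose that for every generic d-polytope P′ in ℝ^d and every weakly non-separable family 𝒫′ = {yⱼ + σⱼP′ : yⱼ ∈ ℝ^d, σⱼ > 0, j = 1, …, m} of positive homothets of P′, some translate of λ(Σⱼ₌₁ᵐ σⱼ)P′ contains ⋃𝒫′. Then for every d-polytope P in ℝ^d and every weakly non-separable family 𝒫 = {xᵢ + τᵢP : xᵢ ∈ ℝ^d, τᵢ > 0, i = 1, …, n} of positive homothets of P, some translate of λ(Σᵢ₌₁ⁿ τᵢ)P contains ⋃𝒫. -/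
open Set Metric Pointwise MeasureTheory

noncomputable section

variable {d : ℕ}

/-- A generic d-polytope: outer unit normal vectors of any d distinct facets
are linearly independent. -/
def IsGenericPolytope (P : Set (Euc d)) : Prop :=
  IsPolytope P ∧ ∀ w : Fin d → Euc d, (∀ i, IsFacetNormal P (w i)) →
    Function.Injective w → LinearIndependent ℝ w

open Filter Topology

/-- The polyhedron `{p | ⟪p, a j⟫ ≤ 1 for all j}`. -/
def polyhedron {ι : Type*} (a : ι → Euc d) : Set (Euc d) :=
  {p | ∀ j, inner ℝ p (a j) ≤ 1}

section Polyhedron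

variable {ι : Type*} {a : ι → Euc d}

lemma convex_polyhedron : Convex ℝ (polyhedron a) := by
  intro p hp q hq s t hs ht hst j
  rw [inner_add_left, real_inner_smul_left, real_inner_smul_left]
  nlinarith [hp j, hq j, mul_le_mul_of_nonneg_left (hp j) hs, mul_le_mul_of_nonneg_left (hq j) ht]

lemma isClosed_polyhedron : IsClosed (polyhedron a) := by
  have : polyhedron a = ⋂ j, {p : Euc d | inner ℝ p (a j) ≤ 1} := by
    ext p; simp [polyhedron]
  rw [this]
  exact isClosed_iInter fun j => isClosed_le (by fun_prop) continuous_const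

lemma zero_mem_interior_polyhedron [Finite ι] : (0 : Euc d) ∈ interior (polyhedron a) := by
  rw [mem_interior_iff_mem_nhds]
  have h : ∀ᶠ p : Euc d in 𝓝 0, ∀ j, inner ℝ p (a j) < 1 := by
    rw [eventually_all]
    intro j
    have hc : Continuous fun p : Euc d => inner ℝ p (a j) := by fun_prop
    exact hc.continuousAt.eventually_lt continuousAt_const (by simp)
  filter_upwards [h] with p hp j using (hp j).le

/-- A point of a polyhedron remains in it after a small move in a direction orthogonal to the
active constraints. -/
lemma eventually_add_smul_mem_polyhedron [Finite ι] {p v : Euc d} (hp : p ∈ polyhedron a)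
    (hv : ∀ j, inner ℝ p (a j) = 1 → inner ℝ v (a j) = 0) :
    ∀ᶠ δ : ℝ in 𝓝 0, p + δ • v ∈ polyhedron a := by
  have h : ∀ᶠ δ : ℝ in 𝓝 0, ∀ j, inner ℝ (p + δ • v) (a j) ≤ 1 := by
    rw [eventually_all]
    intro j
    rcases (hp j).lt_or_eq with hlt | heq
    · have hc : Continuous fun δ : ℝ => inner ℝ (p + δ • v) (a j) := by fun_prop
      refine (hc.continuousAt.eventually_lt continuousAt_const (by simpa using hlt)).mono ?_
      exact fun δ h => h.le
    · refine Eventually.of_forall fun δ => ?_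
      rw [inner_add_left, real_inner_smul_left, hv j heq, heq]
      simp
  exact h

/-- At an extreme point of a polyhedron the active constraints span the space. -/
lemma span_active_eq_top [Finite ι] {p : Euc d} (hp : p ∈ (polyhedron a).extremePoints ℝ) :
    Submodule.span ℝ {y | ∃ j, inner ℝ p (a j) = 1 ∧ a j = y} = ⊤ := by
  rw [← Submodule.orthogonal_eq_bot_iff, Submodule.eq_bot_iff]
  intro v hv
  have hv' : ∀ j, inner ℝ p (a j) = 1 → inner ℝ v (a j) = 0 := fun j hj => by
    have hmem : a j ∈ Submodule.span ℝ {y | ∃ j, inner ℝ p (a j) = 1 ∧ a j = y} :=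
      Submodule.subset_span ⟨j, hj, rfl⟩
    rw [real_inner_comm]
    exact Submodule.inner_right_of_mem_orthogonal hmem hv
  have hv'' : ∀ j, inner ℝ p (a j) = 1 → inner ℝ (-v) (a j) = 0 := fun j hj => by
    rw [inner_neg_left, hv' j hj, neg_zero]
  have h := ((eventually_add_smul_mem_polyhedron hp.1 hv').and
    (eventually_add_smul_mem_polyhedron hp.1 hv'')).filter_mono (nhdsWithin_le_nhds (s := Ioi 0))
  obtain ⟨δ, ⟨h1, h2⟩, hδ⟩ := (h.and self_mem_nhdsWithin).exists
  have hseg : p ∈ openSegment ℝ (p + δ • v) (p + δ • -v) :=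
    ⟨1 / 2, 1 / 2, by norm_num, by norm_num, by norm_num, by module⟩
  have h3 := ((mem_extremePoints.1 hp).2 _ h1 _ h2 hseg).1
  have h4 : δ • v = 0 := by simpa using h3
  exact (smul_eq_zero.1 h4).resolve_left (ne_of_gt hδ)

lemma finite_extremePoints_polyhedron [Finite ι] : ((polyhedron a).extremePoints ℝ).Finite := by
  refine Set.Finite.of_finite_image (f := fun p => {j | inner ℝ p (a j) = 1})
    (Set.toFinite _) ?_
  intro p hp q hq hpq
  have hpq' : ∀ j, inner ℝ p (a j) = 1 → inner ℝ q (a j) = 1 := fun j hj => by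
    have : j ∈ {j | inner ℝ p (a j) = 1} := hj
    rwa [show {j | inner ℝ p (a j) = 1} = {j | inner ℝ q (a j) = 1} from hpq] at this
  have hle : Submodule.span ℝ {y | ∃ j, inner ℝ p (a j) = 1 ∧ a j = y} ≤ (ℝ ∙ (p - q))ᗮ := by
    rw [Submodule.span_le]
    rintro _ ⟨j, hj, rfl⟩
    rw [SetLike.mem_coe, Submodule.mem_orthogonal_singleton_iff_inner_right, inner_sub_left, hj,
      hpq' j hj, sub_self]
  rw [span_active_eq_top hp] at hle
  have := Submodule.mem_orthogonal_singleton_iff_inner_right.1 (hle (Submodule.mem_top (x := p - q)))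
  exact sub_eq_zero.1 (inner_self_eq_zero.1 this)

lemma convexHull_extremePoints_polyhedron [Finite ι] (hb : Bornology.IsBounded (polyhedron a)) :
    convexHull ℝ ((polyhedron a).extremePoints ℝ) = polyhedron a := by
  rw [← (finite_extremePoints_polyhedron.isClosed_convexHull ℝ).closure_eq]
  exact closure_convexHull_extremePoints
    (isCompact_of_isClosed_isBounded isClosed_polyhedron hb) convex_polyhedron

lemma isPolytope_polyhedron [Finite ι] (hb : Bornology.IsBounded (polyhedron a)) :
    IsPolytope (polyhedron a) :=
  ⟨finite_extremePoints_polyhedron.toFinset, by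
    rw [Set.Finite.coe_toFinset, convexHull_extremePoints_polyhedron hb],
    0, zero_mem_interior_polyhedron⟩

end Polyhedron

section Facets

lemma vectorSpan_le_orthogonal {F : Set (Euc d)} {w : Euc d} {c : ℝ}
    (h : ∀ p ∈ F, inner ℝ p w = c) : vectorSpan ℝ F ≤ (ℝ ∙ w)ᗮ := by
  rw [vectorSpan_def, Submodule.span_le]
  rintro _ ⟨p, hp, q, hq, rfl⟩
  change p - q ∈ (ℝ ∙ w)ᗮ
  rw [Submodule.mem_orthogonal_singleton_iff_inner_right, inner_sub_right, real_inner_comm, real_inner_comm q w, h p hp, h q hq, sub_self]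

lemma finrank_orthogonal_singleton {w : Euc d} (hw : w ≠ 0) :
    Module.finrank ℝ (ℝ ∙ w)ᗮ = d - 1 := by
  have h := Submodule.finrank_add_finrank_orthogonal (ℝ ∙ w)
  rw [finrank_span_singleton hw, finrank_euclideanSpace_fin] at h
  omega

/-- Two hyperplanes containing the same `(d-1)`-dimensional set have proportional normals. -/
lemma exists_eq_smul_of_finrank_eq {F : Set (Euc d)} {u w : Euc d} {b c : ℝ}
    (hF : Module.finrank ℝ (vectorSpan ℝ F) = d - 1) (hu : u ≠ 0) (hw : w ≠ 0)
    (hFu : ∀ p ∈ F, inner ℝ p u = b) (hFw : ∀ p ∈ F, inner ℝ p w = c) :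
    ∃ k : ℝ, w = k • u := by
  have h1 := Submodule.eq_of_le_of_finrank_eq (vectorSpan_le_orthogonal hFu)
    (hF.trans (finrank_orthogonal_singleton hu).symm)
  have h2 := Submodule.eq_of_le_of_finrank_eq (vectorSpan_le_orthogonal hFw)
    (hF.trans (finrank_orthogonal_singleton hw).symm)
  have h3 : (ℝ ∙ w) = (ℝ ∙ u) := by
    rw [← Submodule.orthogonal_orthogonal (ℝ ∙ w), ← h2, h1, Submodule.orthogonal_orthogonal]
  have h4 : w ∈ (ℝ ∙ u) := h3 ▸ Submodule.mem_span_singleton_self w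
  obtain ⟨k, hk⟩ := Submodule.mem_span_singleton.1 h4
  exact ⟨k, hk.symm⟩

lemma IsFacetNormal.ne_zero {P : Set (Euc d)} {u : Euc d} (hu : IsFacetNormal P u) : u ≠ 0 :=
  fun h => by simpa [h] using hu.1

lemma IsFacetNormal.finrank_vectorSpan {P : Set (Euc d)} {u : Euc d} (hu : IsFacetNormal P u) :
    Module.finrank ℝ (vectorSpan ℝ (exposedFaceAt P u)) = d - 1 := by
  rw [← direction_affineSpan]
  exact hu.2

lemma IsFacetNormal.nonempty (hd : 2 ≤ d) {P : Set (Euc d)} {u : Euc d}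
    (hu : IsFacetNormal P u) : (exposedFaceAt P u).Nonempty := by
  by_contra h
  have h2 := hu.finrank_vectorSpan
  rw [Set.not_nonempty_iff_eq_empty.1 h, vectorSpan_empty, finrank_bot] at h2
  omega

lemma inner_eq_of_mem_exposedFaceAt {P : Set (Euc d)} {u p q : Euc d}
    (hp : p ∈ exposedFaceAt P u) (hq : q ∈ exposedFaceAt P u) : inner ℝ p u = inner ℝ q u :=
  le_antisymm (hq.2 p hp.1) (hp.2 q hq.1)

lemma convex_exposedFaceAt {P : Set (Euc d)} (hP : Convex ℝ P) (u : Euc d) :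
    Convex ℝ (exposedFaceAt P u) := by
  intro p hp q hq s t hs ht hst
  refine ⟨hP hp.1 hq.1 hs ht hst, fun y hy => ?_⟩
  rw [inner_add_left, real_inner_smul_left, real_inner_smul_left,
    inner_eq_of_mem_exposedFaceAt hq hp, ← add_mul, hst, one_mul]
  exact hp.2 y hy

/-- A nonempty exposed face of a polyhedron lies in the boundary hyperplane of one of the
constraints. -/
lemma exists_exposedFaceAt_subset {ι : Type*} [Finite ι] {a : ι → Euc d} {u : Euc d}
    (hu : u ≠ 0) (hne : (exposedFaceAt (polyhedron a) u).Nonempty) :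
    ∃ j, ∀ p ∈ exposedFaceAt (polyhedron a) u, inner ℝ p (a j) = 1 := by
  classical
  by_contra! hcon
  have key : ∀ s : Finset ι, ∃ p ∈ exposedFaceAt (polyhedron a) u,
      ∀ j ∈ s, inner ℝ p (a j) < 1 := by
    intro s
    induction s using Finset.induction_on with
    | empty => exact ⟨_, hne.some_mem, by simp⟩
    | insert i s hi ih =>
      obtain ⟨p, hp, hps⟩ := ih
      obtain ⟨q, hq, hqi⟩ := hcon i
      have hqi' := lt_of_le_of_ne (hq.1 i) hqi
      refine ⟨(1 / 2 : ℝ) • p + (1 / 2 : ℝ) • q, convex_exposedFaceAt convex_polyhedron u hp hq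
        (by norm_num) (by norm_num) (by norm_num), fun j hj => ?_⟩
      rw [inner_add_left, real_inner_smul_left, real_inner_smul_left]
      rcases Finset.mem_insert.1 hj with rfl | hj
      · linarith [hp.1 j]
      · linarith [hps j hj, hq.1 j]
  cases nonempty_fintype ι
  obtain ⟨p, hp, hlt⟩ := key Finset.univ
  have h := (eventually_add_smul_mem_polyhedron (v := u) hp.1
    fun j hj => absurd hj (hlt j (Finset.mem_univ j)).ne).filter_mono
      (nhdsWithin_le_nhds (s := Ioi 0))
  obtain ⟨δ, hδm, hδ⟩ := (h.and self_mem_nhdsWithin).exists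
  have h2 := hp.2 _ hδm
  rw [inner_add_left, real_inner_smul_left] at h2
  have : 0 < δ * inner ℝ u u := mul_pos hδ (real_inner_self_pos.2 hu)
  linarith

/-- Every facet normal of a polyhedron is a positive multiple of one of the constraint vectors,
and the facet lies in the corresponding boundary hyperplane. -/
lemma IsFacetNormal.exists_eq_smul (hd : 2 ≤ d) {ι : Type*} [Finite ι] {a : ι → Euc d}
    {u : Euc d} (hu : IsFacetNormal (polyhedron a) u) :
    ∃ j, (∃ k : ℝ, 0 < k ∧ a j = k • u) ∧
      ∀ p ∈ exposedFaceAt (polyhedron a) u, inner ℝ p (a j) = 1 := by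
  obtain ⟨p, hp⟩ := hu.nonempty hd
  obtain ⟨j, hj⟩ := exists_exposedFaceAt_subset hu.ne_zero ⟨p, hp⟩
  have haj : a j ≠ 0 := fun h => by simpa [h] using hj p hp
  obtain ⟨k, hk⟩ := exists_eq_smul_of_finrank_eq hu.finrank_vectorSpan hu.ne_zero haj
    (fun q hq => inner_eq_of_mem_exposedFaceAt hq hp) hj
  refine ⟨j, ⟨k, ?_, hk⟩, hj⟩
  have h1 := hj p hp
  rw [hk, real_inner_smul_right] at h1
  have h2 : (0 : ℝ) ≤ inner ℝ p u := by
    simpa using hp.2 0 (interior_subset zero_mem_interior_polyhedron)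
  by_contra! hk0
  nlinarith

/-- A polyhedron whose constraint vectors are in general position is generic. -/
lemma isGenericPolytope_polyhedron (hd : 2 ≤ d) {ι : Type*} [Finite ι] {a : ι → Euc d}
    (hb : Bornology.IsBounded (polyhedron a))
    (ha : ∀ g : Fin d → ι, Function.Injective g → LinearIndependent ℝ (a ∘ g)) :
    IsGenericPolytope (polyhedron a) := by
  refine ⟨isPolytope_polyhedron hb, fun w hw hwi => ?_⟩
  choose g hg _ using fun i => (hw i).exists_eq_smul hd
  choose k hk hgk using hg
  have hg : Function.Injective g := by
    intro i i' h
    have h1 : k i • w i = k i' • w i' := by rw [← hgk, ← hgk, h]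
    have h2 : k i = k i' := by
      have := congrArg norm h1
      rwa [norm_smul, norm_smul, (hw i).1, (hw i').1, mul_one, mul_one, Real.norm_eq_abs,
        Real.norm_eq_abs, abs_of_pos (hk i), abs_of_pos (hk i')] at this
    rw [h2] at h1
    exact hwi (smul_right_injective _ (hk i').ne' h1)
  have h := (ha g hg).units_smul fun i => (Units.mk0 (k i) (hk i).ne')⁻¹
  convert h using 1
  ext1 i
  simp [hgk, Units.smul_def, smul_smul, (hk i).ne']

end Facets

section Representation

/-- If the points of `P` on a supporting hyperplane, seen from `z`, span the space linearly, then
they form a facet of `P`. -/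
lemma isFacetNormal_of_span_eq_top {P T : Set (Euc d)} {z e : Euc d} (he : e ≠ 0)
    (hP : ∀ p ∈ P, inner ℝ (p - z) e ≤ 1) (hT : T ⊆ P) (hTe : ∀ p ∈ T, inner ℝ (p - z) e = 1)
    (hspan : Submodule.span ℝ ((fun p => p - z) '' T) = ⊤) (hd : 2 ≤ d) :
    IsFacetNormal P (‖e‖⁻¹ • e) := by
  have hpos : 0 < ‖e‖⁻¹ := inv_pos.2 (norm_pos_iff.2 he)
  refine ⟨by rw [norm_smul, norm_inv, norm_norm, inv_mul_cancel₀ (norm_ne_zero_iff.2 he)], ?_⟩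
  rw [direction_affineSpan]
  set F := exposedFaceAt P (‖e‖⁻¹ • e) with hF
  have hTF : T ⊆ F := fun p hp => by
    refine ⟨hT hp, fun y hy => ?_⟩
    rw [real_inner_smul_right, real_inner_smul_right]
    refine mul_le_mul_of_nonneg_left ?_ hpos.le
    have h1 := hTe p hp
    have h2 := hP y hy
    rw [inner_sub_left] at h1 h2
    linarith
  have hTne : T.Nonempty := by
    by_contra h
    rw [Set.not_nonempty_iff_eq_empty.1 h, Set.image_empty, Submodule.span_empty] at hspan
    have h3 := congrArg (fun W : Submodule ℝ (Euc d) => Module.finrank ℝ W) hspan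
    simp only [finrank_bot, finrank_top, finrank_euclideanSpace_fin] at h3
    omega
  obtain ⟨s, hs⟩ := hTne
  refine le_antisymm ?_ ?_
  · rw [← finrank_orthogonal_singleton (smul_ne_zero hpos.ne' he)]
    exact Submodule.finrank_mono (vectorSpan_le_orthogonal
      fun p hp => inner_eq_of_mem_exposedFaceAt hp (hTF hs))
  · have hle : (⊤ : Submodule ℝ (Euc d)) ≤ vectorSpan ℝ F ⊔ (ℝ ∙ (s - z)) := by
      rw [← hspan, Submodule.span_le]
      rintro _ ⟨p, hp, rfl⟩
      have : p - z = (p -ᵥ s) + (s - z) := by simp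
      simp only [this]
      exact Submodule.add_mem_sup (vsub_mem_vectorSpan ℝ (hTF hp) (hTF hs))
        (Submodule.mem_span_singleton_self _)
    have h1 := Submodule.finrank_mono hle
    have h2 := Submodule.finrank_add_le_finrank_add_finrank (vectorSpan ℝ F) (ℝ ∙ (s - z))
    have h3 := finrank_span_le_card (R := ℝ) ({s - z} : Set (Euc d))
    simp only [Set.toFinset_singleton, Finset.card_singleton] at h3
    rw [finrank_top, finrank_euclideanSpace_fin] at h1
    omega

/-- A polytope is cut out by its facets. -/
lemma IsPolytope.exists_facet_representation_s8 (hd : 2 ≤ d) {P : Set (Euc d)} (hP : IsPolytope P) :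
    ∃ (z : Euc d) (N : ℕ) (e : Fin N → Euc d), (∀ p, p ∈ P ↔ p - z ∈ polyhedron e) ∧
      (∀ j, e j ≠ 0) ∧ ∀ j, IsFacetNormal P (‖e j‖⁻¹ • e j) := by
  obtain ⟨S, hPS, z, hz⟩ := hP
  set a : S → Euc d := fun s => s - z with ha
  have hpolar : ∀ y, y ∈ polyhedron a ↔ ∀ p ∈ P, inner ℝ (p - z) y ≤ 1 := by
    intro y
    constructor
    · intro hy p hp
      rw [hPS] at hp
      have hc : Convex ℝ {p : Euc d | inner ℝ (p - z) y ≤ 1} := by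
        intro p hp q hq s t hs ht hst
        simp only [Set.mem_ofPred_eq, inner_sub_left, inner_add_left, real_inner_smul_left] at *
        have hst' : inner ℝ z y = s * inner ℝ z y + t * inner ℝ z y := by
          rw [← add_mul, hst, one_mul]
        nlinarith [mul_le_mul_of_nonneg_left hp hs, mul_le_mul_of_nonneg_left hq ht]
      refine convexHull_min (fun s hs => ?_) hc hp
      rw [Set.mem_ofPred_eq, real_inner_comm]
      exact hy ⟨s, hs⟩
    · intro hy s
      rw [real_inner_comm]
      exact hy s (hPS ▸ subset_convexHull ℝ _ s.2)
  have hzP : z ∈ P := interior_subset hz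
  have hb : Bornology.IsBounded (polyhedron a) := by
    obtain ⟨r, hr, hball⟩ := Metric.isOpen_iff.1 isOpen_interior z hz
    refine isBounded_iff_forall_norm_le.2 ⟨2 / r, fun y hy => ?_⟩
    rcases eq_or_ne y 0 with rfl | hy0
    · simp only [norm_zero]; positivity
    have hn : 0 < ‖y‖ := norm_pos_iff.2 hy0
    have h1 := (hpolar y).1 hy (z + (r / 2 * ‖y‖⁻¹) • y) (interior_subset (hball ?_))
    · rw [add_sub_cancel_left, real_inner_smul_left, real_inner_self_eq_norm_sq] at h1
      rw [le_div_iff₀ hr]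
      field_simp at h1
      linarith
    · rw [Metric.mem_ball, dist_eq_norm, add_sub_cancel_left, norm_smul, Real.norm_eq_abs,
        abs_of_pos (by positivity), mul_assoc, inv_mul_cancel₀ hn.ne']
      linarith
  obtain ⟨N, e, -, he⟩ := (finite_extremePoints_polyhedron (a := a)).fin_param
  have hext : ∀ j, e j ∈ (polyhedron a).extremePoints ℝ := fun j => he ▸ Set.mem_range_self j
  have hle : ∀ j, ∀ p ∈ P, inner ℝ (p - z) (e j) ≤ 1 := fun j => (hpolar _).1 (hext j).1
  have hspan : ∀ j, Submodule.span ℝ ((fun p => p - z) ''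
      {p | p ∈ S ∧ inner ℝ (p - z) (e j) = 1}) = ⊤ := by
    intro j
    rw [← span_active_eq_top (hext j)]
    congr 1
    ext y
    constructor
    · rintro ⟨p, ⟨hpS, hp⟩, rfl⟩
      exact ⟨⟨p, hpS⟩, by rwa [real_inner_comm], rfl⟩
    · rintro ⟨p, hp, rfl⟩
      exact ⟨p, ⟨p.2, by rwa [real_inner_comm] at hp⟩, rfl⟩
  have hne : ∀ j, e j ≠ 0 := by
    intro j h0
    have h1 := hspan j
    simp only [h0, inner_zero_right, zero_ne_one, and_false, Set.ofPred_false, Set.image_empty,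
      Submodule.span_empty] at h1
    have h3 := congrArg (fun W : Submodule ℝ (Euc d) => Module.finrank ℝ W) h1
    simp only [finrank_bot, finrank_top, finrank_euclideanSpace_fin] at h3
    omega
  refine ⟨z, N, e, fun p => ⟨fun hp j => hle j p hp, fun hp => ?_⟩, hne, fun j =>
    isFacetNormal_of_span_eq_top (hne j) (hle j)
      (fun p hp => hPS ▸ subset_convexHull ℝ _ hp.1) (fun p hp => hp.2) (hspan j) hd⟩
  by_contra hpP
  have hclosed : IsClosed P := hPS ▸ S.finite_toSet.isClosed_convexHull ℝ
  have hconv : Convex ℝ P := hPS ▸ convex_convexHull ℝ _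
  obtain ⟨f, c, hfc, hfp⟩ := geometric_hahn_banach_closed_point hconv hclosed hpP
  set y := (InnerProductSpace.toDual ℝ (Euc d)).symm f with hy
  have hf : ∀ q, f q = inner ℝ q y := fun q => by
    rw [real_inner_comm, hy, InnerProductSpace.toDual_symm_apply]
  have hα : 0 < c - f z := sub_pos.2 (hfc z hzP)
  have hmem : (c - f z)⁻¹ • y ∈ polyhedron a := by
    refine (hpolar _).2 fun q hq => ?_
    rw [real_inner_smul_right, ← hf, map_sub, inv_mul_le_one₀ hα]
    linarith [hfc q hq]
  rw [← convexHull_extremePoints_polyhedron hb] at hmem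
  have hc : Convex ℝ {w : Euc d | inner ℝ (p - z) w ≤ 1} := by
    intro u hu w hw s t hs ht hst
    simp only [Set.mem_ofPred_eq, inner_add_right, real_inner_smul_right] at *
    nlinarith [mul_le_mul_of_nonneg_left hu hs, mul_le_mul_of_nonneg_left hw ht]
  have h1 := convexHull_min (t := {w : Euc d | inner ℝ (p - z) w ≤ 1}) (fun w hw => by
    rw [← he] at hw
    obtain ⟨j, rfl⟩ := hw
    exact hp j) hc hmem
  rw [Set.mem_ofPred_eq, real_inner_smul_right, ← hf, map_sub, inv_mul_le_one₀ hα] at h1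
  linarith

end Representation

section Perturbation

/-- Any finite family of vectors can be moved into general position along straight lines. -/
lemma exists_eventually_linearIndependent {N : ℕ} (e : Fin N → Euc d) :
    ∃ v : Fin N → Euc d, ∀ᶠ t : ℝ in 𝓝[>] 0, ∀ g : Fin d → Fin N, Function.Injective g →
      LinearIndependent ℝ ((fun j => e j + t • v j) ∘ g) := by
  refine ⟨fun j => WithLp.toLp 2 fun k => ((j : ℕ) : ℝ) ^ (k : ℕ), ?_⟩
  rw [eventually_all]
  intro g
  by_cases hg : Function.Injective g
  swap
  · exact Eventually.of_forall fun t h => absurd h hg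
  set A : Matrix (Fin d) (Fin d) ℝ := Matrix.vandermonde fun i => ((g i : ℕ) : ℝ) with hA
  set B : Matrix (Fin d) (Fin d) ℝ := Matrix.of fun i k => e (g i) k with hB
  set q : Polynomial ℝ :=
    ((Polynomial.X : Polynomial ℝ) • A.map Polynomial.C + B.map Polynomial.C).det with hq
  have hq0 : q ≠ 0 := by
    intro h
    have h1 := Polynomial.coeff_det_X_add_C_card A B
    rw [← hq, h, Polynomial.coeff_zero] at h1
    refine Matrix.det_vandermonde_ne_zero_iff.2 ?_ h1.symm
    exact Nat.cast_injective.comp (Fin.val_injective.comp hg)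
  have hev : ∀ᶠ t : ℝ in 𝓝[>] 0, t ∉ ((q.roots.toFinset : Set ℝ) \ {0}) := by
    refine nhdsWithin_le_nhds (IsOpen.mem_nhds ?_ (by simp))
    exact (q.roots.toFinset.finite_toSet.subset Set.sdiff_subset).isClosed.isOpen_compl
  filter_upwards [hev, self_mem_nhdsWithin] with t ht ht0 _
  have hdet : (t • A + B).det ≠ 0 := by
    intro h0
    refine ht ⟨?_, ne_of_gt ht0⟩
    rw [Finset.mem_coe, Multiset.mem_toFinset, Polynomial.mem_roots hq0, Polynomial.IsRoot.def,
      hq, ← Polynomial.coe_evalRingHom, RingHom.map_det]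
    convert h0 using 2
    ext i k
    simp only [RingHom.mapMatrix_apply, Matrix.map_apply, Matrix.add_apply, Matrix.smul_apply,
      smul_eq_mul, Polynomial.coe_evalRingHom, Polynomial.eval_add, Polynomial.eval_mul,
      Polynomial.eval_X, Polynomial.eval_C]
  have hli := Matrix.linearIndependent_rows_iff_isUnit.2
    ((Matrix.isUnit_iff_isUnit_det _).2 (isUnit_iff_ne_zero.2 hdet))
  refine LinearIndependent.of_comp (WithLp.linearEquiv 2 ℝ (Fin d → ℝ)).toLinearMap ?_
  have hrow : (WithLp.linearEquiv 2 ℝ (Fin d → ℝ)).toLinearMap ∘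
      ((fun j => e j + t • WithLp.toLp 2 fun k : Fin d => ((j : ℕ) : ℝ) ^ (k : ℕ)) ∘ g) =
      (t • A + B).row := by
    ext i k
    simp [hA, hB, Matrix.row, Matrix.vandermonde, add_comm]
  rw [hrow]
  exact hli

lemma mem_homo {x p : Euc d} {τ : ℝ} (hτ : 0 < τ) {P : Set (Euc d)} :
    p ∈ homo x τ P ↔ τ⁻¹ • (p - x) ∈ P := by
  rw [homo, Set.singleton_add, Set.mem_image]
  constructor
  · rintro ⟨_, ⟨q, hq, rfl⟩, rfl⟩
    simpa [smul_smul, hτ.ne'] using hq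
  · exact fun h => ⟨_, Set.smul_mem_smul_set h, by simp [smul_smul, hτ.ne']⟩

lemma mem_homo_polyhedron {ι : Type*} {a : ι → Euc d} {x p : Euc d} {τ : ℝ} (hτ : 0 < τ) :
    p ∈ homo x τ (polyhedron a) ↔ ∀ j, inner ℝ (p - x) (a j) ≤ τ := by
  rw [mem_homo hτ]
  refine forall_congr' fun j => ?_
  rw [real_inner_smul_left, inv_mul_le_one₀ hτ]

lemma mem_homo_of_representation {ι : Type*} {a : ι → Euc d} {P : Set (Euc d)} {z : Euc d}
    (hP : ∀ p, p ∈ P ↔ p - z ∈ polyhedron a) {x p : Euc d} {τ : ℝ} (hτ : 0 < τ) :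
    p ∈ homo x τ P ↔ ∀ j, inner ℝ (p - (x + τ • z)) (a j) ≤ τ := by
  rw [← mem_homo_polyhedron hτ, mem_homo hτ, mem_homo hτ, hP]
  congr! 1
  rw [← sub_sub, smul_sub _ (p - x), smul_smul, inv_mul_cancel₀ hτ.ne', one_smul]

lemma convex_homo {x : Euc d} {τ : ℝ} {P : Set (Euc d)} (hP : Convex ℝ P) :
    Convex ℝ (homo x τ P) :=
  (convex_singleton x).add (hP.smul τ)

variable {ι : Type*} [Finite ι] (e v : ι → Euc d) {ε : ℝ}

lemma eventually_inner_perturbation_lt {p : Euc d} {b : ℝ} (h : ∀ j, inner ℝ p (e j) < b) :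
    ∀ᶠ t : ℝ in 𝓝[>] 0, ∀ j, inner ℝ p (e j + t • v j) < b := by
  refine nhdsWithin_le_nhds (eventually_all.2 fun j => ?_)
  have hc : Continuous fun t : ℝ => inner ℝ p (e j + t • v j) := by fun_prop
  exact hc.continuousAt.eventually_lt continuousAt_const (by simpa using h j)

/-- A bounded polyhedron is, up to a factor `1 + ε`, contained in its small perturbations. -/
lemma eventually_le_of_mem_polyhedron (hb : Bornology.IsBounded (polyhedron e)) (hε : 0 < ε) :
    ∀ᶠ t : ℝ in 𝓝[>] 0, ∀ p ∈ polyhedron e, ∀ j, inner ℝ p (e j + t • v j) ≤ 1 + ε := by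
  obtain ⟨S, hS, -⟩ := isPolytope_polyhedron hb
  have h : ∀ᶠ t : ℝ in 𝓝[>] 0, ∀ p ∈ S, ∀ j, inner ℝ p (e j + t • v j) < 1 + ε := by
    rw [eventually_all_finset]
    intro p hp
    refine eventually_inner_perturbation_lt e v fun j => ?_
    have : p ∈ polyhedron e := hS ▸ subset_convexHull ℝ _ hp
    linarith [this j]
  filter_upwards [h] with t ht p hp j
  rw [hS] at hp
  have hc : Convex ℝ {p : Euc d | inner ℝ p (e j + t • v j) ≤ 1 + ε} :=
    convex_halfSpace_le (f := fun p : Euc d => inner ℝ p (e j + t • v j))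
      ⟨fun p q => inner_add_left p q _, fun s p => real_inner_smul_left p _ s⟩ _
  exact convexHull_min (fun p hp => (ht p hp j).le) hc hp

/-- Small perturbations of a bounded polyhedron are, up to a factor `1 + ε`, contained in it. -/
lemma eventually_le_of_mem_perturbation (hb : Bornology.IsBounded (polyhedron e)) (hε : 0 < ε) :
    ∀ᶠ t : ℝ in 𝓝[>] 0, ∀ p ∈ polyhedron (fun j => e j + t • v j),
      ∀ j, inner ℝ p (e j) ≤ 1 + ε := by
  obtain ⟨R, hR⟩ := isBounded_iff_forall_norm_le.1 hb
  have hR0 : 0 ≤ R := (norm_nonneg _).trans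
    (hR 0 (interior_subset zero_mem_interior_polyhedron))
  have h : ∀ᶠ t : ℝ in 𝓝[>] 0, ∀ j, t * (R * ‖v j‖) * (1 + ε) < ε := by
    refine nhdsWithin_le_nhds (eventually_all.2 fun j => ?_)
    have hc : Continuous fun t : ℝ => t * (R * ‖v j‖) * (1 + ε) := by fun_prop
    exact hc.continuousAt.eventually_lt continuousAt_const (by simpa using hε)
  filter_upwards [h, self_mem_nhdsWithin] with t ht ht0 p hp j
  have : Nonempty ι := ⟨j⟩
  obtain ⟨i, hi⟩ := Finite.exists_max fun j => inner ℝ p (e j)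
  refine (hi j).trans ?_
  by_contra! hM
  set M := inner ℝ p (e i) with hMdef
  have hM0 : 0 < M := by linarith
  have hnorm : ‖p‖ ≤ R * M := by
    have h1 := hR (M⁻¹ • p) fun k => by
      rw [real_inner_smul_left, inv_mul_le_one₀ hM0]
      exact hi k
    rwa [norm_smul, norm_inv, Real.norm_eq_abs, abs_of_pos hM0, inv_mul_le_iff₀ hM0,
      mul_comm] at h1
  have h1 := hp i
  simp only [inner_add_right, real_inner_smul_right] at h1
  have h2 : -(R * M * ‖v i‖) ≤ inner ℝ p (v i) := by
    have := (abs_le.1 (abs_real_inner_le_norm p (v i))).1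
    nlinarith [mul_le_mul_of_nonneg_right hnorm (norm_nonneg (v i))]
  have h3 := mul_le_mul_of_nonneg_left h2 (le_of_lt ht0)
  have h4 : M * (t * (R * ‖v i‖) * (1 + ε)) < M * ε := mul_lt_mul_of_pos_left (ht i) hM0
  nlinarith

end Perturbation

section Separation

lemma exists_inner_eq_of_convex {C : Set (Euc d)} (hC : Convex ℝ C) {w p q : Euc d} {c : ℝ}
    (hp : p ∈ C) (hq : q ∈ C) (hpc : inner ℝ p w ≤ c) (hcq : c ≤ inner ℝ q w) :
    ∃ r ∈ C, inner ℝ r w = c := by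
  have hc : Continuous fun r : Euc d => inner ℝ r w := by fun_prop
  exact hC.isPreconnected.intermediate_value hp hq hc.continuousOn ⟨hpc, hcq⟩

lemma forall_inner_lt_or_forall_lt_inner {C : Set (Euc d)} (hC : Convex ℝ C) {w : Euc d} {c : ℝ}
    (h : ∀ p ∈ C, inner ℝ p w ≠ c) :
    (∀ p ∈ C, inner ℝ p w < c) ∨ ∀ p ∈ C, c < inner ℝ p w := by
  by_contra! hcon
  obtain ⟨⟨q, hq, hcq⟩, p, hp, hpc⟩ := hcon
  obtain ⟨r, hr, hrc⟩ := exists_inner_eq_of_convex hC hp hq hpc hcq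
  exact h r hr hrc

/-- A hyperplane orthogonal to a facet normal is parallel to the facet. -/
lemma IsFacetNormal.hypParallelToFacet {P : Set (Euc d)} {w : Euc d} (hw : w ≠ 0)
    (h : IsFacetNormal P (‖w‖⁻¹ • w)) (c : ℝ) :
    HypParallelToFacet P {p : Euc d | inner ℝ p w = c} := by
  refine ⟨_, h, ?_⟩
  rcases (exposedFaceAt P (‖w‖⁻¹ • w)).eq_empty_or_nonempty with h0 | ⟨s, hs⟩
  · exact ⟨0, h0 ▸ Set.empty_subset _⟩
  refine ⟨s - (c / inner ℝ w w) • w, fun p hp => ⟨p - (s - (c / inner ℝ w w) • w), ?_, by simp⟩⟩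
  have h1 := inner_eq_of_mem_exposedFaceAt hp hs
  rw [real_inner_smul_right, real_inner_smul_right] at h1
  have h2 := mul_left_cancel₀ (inv_ne_zero (norm_ne_zero_iff.2 hw)) h1
  rw [Set.mem_ofPred_eq, inner_sub_left, inner_sub_left, real_inner_smul_left, h2,
    div_mul_cancel₀ _ (real_inner_self_pos.2 hw).ne']
  ring

/-- A hyperplane parallel to a facet of a polyhedron is a level set of one of the
constraints. -/
lemma exists_eq_level_of_hypParallelToFacet (hd : 2 ≤ d) {ι : Type*} [Finite ι] {a : ι → Euc d}
    {H : Set (Euc d)} (hH : IsHyperplane H) (hpar : HypParallelToFacet (polyhedron a) H) :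
    ∃ j c, H = {p : Euc d | inner ℝ p (a j) = c} := by
  obtain ⟨w, hw, c, rfl⟩ := hH
  obtain ⟨u, hu, s, hs⟩ := hpar
  obtain ⟨j, ⟨k, hk, hjk⟩, -⟩ := hu.exists_eq_smul hd
  obtain ⟨p, hp⟩ := hu.nonempty hd
  obtain ⟨l, hl⟩ := exists_eq_smul_of_finrank_eq (b := inner ℝ p u) (c := inner ℝ s w + c)
    hu.finrank_vectorSpan hu.ne_zero hw (fun q hq => inner_eq_of_mem_exposedFaceAt hq hp)
    (fun q hq => by
      obtain ⟨r, hr, rfl⟩ := hs hq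
      rw [inner_add_left, show inner ℝ r w = c from hr])
  have hl0 : l ≠ 0 := fun h => hw (by rw [hl, h, zero_smul])
  refine ⟨j, k / l * c, Set.ext fun q => ?_⟩
  rw [Set.mem_ofPred_eq, Set.mem_ofPred_eq, hl, hjk, real_inner_smul_right, real_inner_smul_right]
  constructor
  · intro h
    rw [← h]
    field_simp
  · intro h
    field_simp at h
    linarith

variable {P : Set (Euc d)} {n : ℕ} {x : Fin n → Euc d} {τ : Fin n → ℝ}

/-- In a weakly non-separable family, two complementary nonempty subfamilies are not strictly
separated by a hyperplane parallel to a facet. -/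
lemma WNS.exists_inner_le (hW : WNS P x τ) (hPc : IsCompact P)
    (hPne : P.Nonempty) {w : Euc d} (hw : w ≠ 0) (hfacet : IsFacetNormal P (‖w‖⁻¹ • w))
    {A B : Set (Fin n)} (hAB : ∀ i, i ∈ A ∨ i ∈ B) (hA : A.Nonempty) (hB : B.Nonempty) :
    ∃ a ∈ A, ∃ b ∈ B, ∃ p ∈ homo (x a) (τ a) P, ∃ q ∈ homo (x b) (τ b) P,
      inner ℝ p w ≤ inner ℝ q w := by
  by_contra! hcon
  have hc : Continuous fun r : Euc d => inner ℝ r w := by fun_prop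
  have hcomp : ∀ i, IsCompact (homo (x i) (τ i) P) := fun i =>
    isCompact_singleton.add (hPc.smul (τ i))
  have hne : ∀ i, (homo (x i) (τ i) P).Nonempty := fun i =>
    (Set.singleton_nonempty _).add hPne.smul_set
  have hAc : IsCompact (⋃ i ∈ A, homo (x i) (τ i) P) :=
    (Set.toFinite A).isCompact_biUnion fun i _ => hcomp i
  have hBc : IsCompact (⋃ i ∈ B, homo (x i) (τ i) P) :=
    (Set.toFinite B).isCompact_biUnion fun i _ => hcomp i
  have hAne : (⋃ i ∈ A, homo (x i) (τ i) P).Nonempty := by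
    obtain ⟨i, hi⟩ := hA
    obtain ⟨p, hp⟩ := hne i
    exact ⟨p, Set.mem_biUnion hi hp⟩
  have hBne : (⋃ i ∈ B, homo (x i) (τ i) P).Nonempty := by
    obtain ⟨i, hi⟩ := hB
    obtain ⟨p, hp⟩ := hne i
    exact ⟨p, Set.mem_biUnion hi hp⟩
  obtain ⟨p, hp, hpmin⟩ := hAc.exists_isMinOn hAne hc.continuousOn
  obtain ⟨q, hq, hqmax⟩ := hBc.exists_isMaxOn hBne hc.continuousOn
  obtain ⟨a, ha, hpa⟩ := Set.mem_iUnion₂.1 hp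
  obtain ⟨b, hb, hqb⟩ := Set.mem_iUnion₂.1 hq
  have hlt := hcon a ha b hb p hpa q hqb
  have hsub : ∀ i, homo (x i) (τ i) P ⊆ convexHull ℝ (⋃ i, homo (x i) (τ i) P) := fun i =>
    (Set.subset_iUnion (fun i => homo (x i) (τ i) P) i).trans (subset_convexHull ℝ _)
  obtain ⟨r, hr, hrc⟩ := exists_inner_eq_of_convex (convex_convexHull ℝ _) (hsub b hqb)
    (hsub a hpa) (c := (inner ℝ q w + inner ℝ p w) / 2) (w := w) (by linarith) (by linarith)
  obtain ⟨i, s, hsH, hs⟩ := hW _ ⟨w, hw, _, rfl⟩ (hfacet.hypParallelToFacet hw _) ⟨r, hrc, hr⟩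
  have hsw : inner ℝ s w = (inner ℝ q w + inner ℝ p w) / 2 := hsH
  rcases hAB i with hi | hi
  · have : inner ℝ p w ≤ inner ℝ s w := hpmin (Set.mem_biUnion hi hs)
    linarith
  · have : inner ℝ s w ≤ inner ℝ q w := hqmax (Set.mem_biUnion hi hs)
    linarith

variable {ι : Type*} [Finite ι] {e : ι → Euc d} {z : Euc d} {ε : ℝ}

lemma exists_add_smul_inner_lt {r : Euc d} {b c : ℝ} (hr : ∀ i, inner ℝ r (e i) ≤ b)
    (hbc : b < c) (w : Euc d) : ∃ δ : ℝ, 0 < δ ∧ ∀ i, inner ℝ (r + δ • w) (e i) < c := by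
  have h : ∀ᶠ δ : ℝ in 𝓝 0, ∀ i, inner ℝ (r + δ • w) (e i) < c := by
    refine eventually_all.2 fun i => ?_
    have hc : Continuous fun δ : ℝ => inner ℝ (r + δ • w) (e i) := by fun_prop
    exact hc.continuousAt.eventually_lt continuousAt_const (by simpa using (hr i).trans_lt hbc)
  obtain ⟨δ, h1, h2⟩ :=
    ((h.filter_mono (nhdsWithin_le_nhds (s := Ioi 0))).and self_mem_nhdsWithin).exists
  exact ⟨δ, h2, h1⟩

/-- Homothets not strictly separated in a facet direction overlap robustly in that direction after
enlarging and perturbing. -/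
lemma eventually_exists_inner_lt (hP : ∀ p, p ∈ P ↔ p - z ∈ polyhedron e) (v : ι → Euc d)
    (hε : 0 < ε) (hτ : ∀ i, 0 < τ i) {j : ι} (hj : e j ≠ 0) {a b : Fin n} {p q : Euc d}
    (hp : p ∈ homo (x a) (τ a) P) (hq : q ∈ homo (x b) (τ b) P)
    (hpq : inner ℝ p (e j) ≤ inner ℝ q (e j)) :
    ∀ᶠ t : ℝ in 𝓝[>] 0,
      ∃ p' ∈ homo (x a + τ a • z) ((1 + ε) * τ a) (polyhedron fun i => e i + t • v i),
      ∃ q' ∈ homo (x b + τ b • z) ((1 + ε) * τ b) (polyhedron fun i => e i + t • v i),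
        inner ℝ p' (e j + t • v j) < inner ℝ q' (e j + t • v j) := by
  have hlt : ∀ i, τ i < (1 + ε) * τ i := fun i => by nlinarith [hτ i, mul_pos hε (hτ i)]
  obtain ⟨δ, hδ, hpδ⟩ := exists_add_smul_inner_lt
    ((mem_homo_of_representation hP (hτ a)).1 hp) (hlt a) (-e j)
  have h1 := eventually_inner_perturbation_lt e v hpδ
  have h2 := eventually_inner_perturbation_lt e v
    (fun i => ((mem_homo_of_representation hP (hτ b)).1 hq i).trans_lt (hlt b))
  have h3 : ∀ᶠ t : ℝ in 𝓝[>] 0,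
      inner ℝ (p + δ • -e j) (e j + t • v j) < inner ℝ q (e j + t • v j) := by
    have hc : ∀ r : Euc d, Continuous fun t : ℝ => inner ℝ r (e j + t • v j) :=
      fun r => by fun_prop
    refine nhdsWithin_le_nhds ((hc _).continuousAt.eventually_lt (hc _).continuousAt ?_)
    simp only [zero_smul, add_zero, inner_add_left, real_inner_smul_left, inner_neg_left]
    linarith [mul_pos hδ (real_inner_self_pos.2 hj)]
  filter_upwards [h1, h2, h3] with t h1 h2 h3
  have hε' : ∀ i, 0 < (1 + ε) * τ i := fun i => (hτ i).trans (hlt i)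
  refine ⟨p + δ • -e j, (mem_homo_polyhedron (hε' a)).2 fun i => ?_, q,
    (mem_homo_polyhedron (hε' b)).2 fun i => (h2 i).le, h3⟩
  rw [add_sub_right_comm]
  exact (h1 i).le

/-- Weak non-separability survives enlarging the homothets and then perturbing the polytope. -/
lemma WNS.eventually_perturbation (hd : 2 ≤ d) (hW : WNS P x τ) (hτ : ∀ i, 0 < τ i)
    (hPc : IsCompact P) (hPne : P.Nonempty) (hP : ∀ p, p ∈ P ↔ p - z ∈ polyhedron e)
    (he : ∀ j, e j ≠ 0) (hfacet : ∀ j, IsFacetNormal P (‖e j‖⁻¹ • e j)) (v : ι → Euc d)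
    (hε : 0 < ε) :
    ∀ᶠ t : ℝ in 𝓝[>] 0, WNS (polyhedron fun j => e j + t • v j)
      (fun i => x i + τ i • z) (fun i => (1 + ε) * τ i) := by
  have hev : ∀ᶠ t : ℝ in 𝓝[>] 0, ∀ (j : ι) (a b : Fin n),
      (∃ p ∈ homo (x a) (τ a) P, ∃ q ∈ homo (x b) (τ b) P, inner ℝ p (e j) ≤ inner ℝ q (e j)) →
      ∃ p' ∈ homo (x a + τ a • z) ((1 + ε) * τ a) (polyhedron fun i => e i + t • v i),
      ∃ q' ∈ homo (x b + τ b • z) ((1 + ε) * τ b) (polyhedron fun i => e i + t • v i),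
        inner ℝ p' (e j + t • v j) < inner ℝ q' (e j + t • v j) := by
    refine eventually_all.2 fun j => eventually_all.2 fun a => eventually_all.2 fun b => ?_
    by_cases h : ∃ p ∈ homo (x a) (τ a) P, ∃ q ∈ homo (x b) (τ b) P,
        inner ℝ p (e j) ≤ inner ℝ q (e j)
    · obtain ⟨p, hp, q, hq, hpq⟩ := h
      exact (eventually_exists_inner_lt hP v hε hτ (he j) hp hq hpq).mono fun t ht _ => ht
    · exact Eventually.of_forall fun t h' => absurd h' h
  filter_upwards [hev] with t ht H hH hpar hmeet
  obtain ⟨j, c, rfl⟩ := exists_eq_level_of_hypParallelToFacet hd hH hpar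
  obtain ⟨r, hrc, hr⟩ := hmeet
  by_contra! hcon
  set Q := polyhedron fun i => e i + t • v i with hQ
  set w := e j + t • v j with hw
  set C : Fin n → Set (Euc d) := fun i => homo (x i + τ i • z) ((1 + ε) * τ i) Q with hC
  have hside : ∀ i, (∀ p ∈ C i, inner ℝ p w < c) ∨ ∀ p ∈ C i, c < inner ℝ p w := fun i =>
    forall_inner_lt_or_forall_lt_inner (convex_homo convex_polyhedron) fun p hp hpc =>
      Set.notMem_empty p (hcon i ▸ ⟨hpc, hp⟩)
  have hlin : IsLinearMap ℝ fun p : Euc d => inner ℝ p w :=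
    ⟨fun p q => inner_add_left p q _, fun s p => real_inner_smul_left p _ s⟩
  have hrw : inner ℝ r w = c := hrc
  have hA : {i | ∀ p ∈ C i, c < inner ℝ p w}.Nonempty := by
    by_contra h
    have hlt : ∀ i, ∀ p ∈ C i, inner ℝ p w < c := fun i =>
      (hside i).resolve_right fun hi => h ⟨i, hi⟩
    have : inner ℝ r w < c :=
      convexHull_min (Set.iUnion_subset hlt) (convex_halfSpace_lt hlin c) hr
    linarith
  have hB : {i | ∀ p ∈ C i, inner ℝ p w < c}.Nonempty := by
    by_contra h
    have hlt : ∀ i, ∀ p ∈ C i, c < inner ℝ p w := fun i =>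
      (hside i).resolve_left fun hi => h ⟨i, hi⟩
    have : c < inner ℝ r w :=
      convexHull_min (Set.iUnion_subset hlt) (convex_halfSpace_gt hlin c) hr
    linarith
  obtain ⟨a, ha, b, hb, hab⟩ := hW.exists_inner_le hPc hPne (he j) (hfacet j)
    (fun i => (hside i).symm) hA hB
  obtain ⟨p, hp, q, hq, hpq⟩ := ht j a b hab
  exact absurd hpq (not_lt.2 ((hb q hq).le.trans (ha p hp).le))

end Separation

/-- a covering bound for WNS-families of generic d-polytopes
transfers to WNS-families of arbitrary d-polytopes. -/
theorem stmt_8 (d : ℕ) (hd : 2 ≤ d) (lam : ℝ) (hlam : 0 < lam)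
    (hgen : ∀ P' : Set (Euc d), IsGenericPolytope P' →
      ∀ (m : ℕ) (y : Fin m → Euc d) (σ : Fin m → ℝ), (∀ j, 0 < σ j) →
      WNS P' y σ →
      ∃ c : Euc d, (⋃ j, homo (y j) (σ j) P') ⊆ homo c (lam * ∑ j, σ j) P') :
    ∀ P : Set (Euc d), IsPolytope P →
      ∀ (n : ℕ) (x : Fin n → Euc d) (τ : Fin n → ℝ), (∀ i, 0 < τ i) →
      WNS P x τ →
      ∃ c : Euc d, (⋃ i, homo (x i) (τ i) P) ⊆ homo c (lam * ∑ i, τ i) P := by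
  intro P hP n x τ hτ hW
  rcases Nat.eq_zero_or_pos n with rfl | hn
  · exact ⟨0, by simp⟩
  obtain ⟨z, N, e, hPe, he, hfacet⟩ := hP.exists_facet_representation_s8 hd
  obtain ⟨hPc, hPne⟩ : IsCompact P ∧ P.Nonempty := by
    obtain ⟨S, hS, hint⟩ := hP
    exact ⟨hS ▸ S.finite_toSet.isCompact_convexHull ℝ, hint.mono interior_subset⟩
  have hb : Bornology.IsBounded (polyhedron e) := by
    refine (hPc.image (continuous_sub_right z)).isBounded.subset fun p hp => ?_
    exact ⟨p + z, (hPe _).2 (by simpa using hp), by simp⟩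
  obtain ⟨v, hv⟩ := exists_eventually_linearIndependent e
  have : Nonempty (Fin n) := ⟨⟨0, hn⟩⟩
  have hs : 0 < lam * ∑ i, τ i :=
    mul_pos hlam (Finset.sum_pos (fun i _ => hτ i) Finset.univ_nonempty)
  set s := lam * ∑ i, τ i with hsdef
  have happrox : ∀ ε : ℝ, 0 < ε → ∃ c : Euc d, ∀ i, ∀ p ∈ homo (x i) (τ i) P, ∀ j,
      inner ℝ (p - c) (e j) ≤ s * (1 + ε) ^ 2 := by
    intro ε hε
    obtain ⟨t, hvt, hWt, hin, hout⟩ := (hv.and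
      ((hW.eventually_perturbation hd hτ hPc hPne hPe he hfacet v hε).and
        ((eventually_le_of_mem_polyhedron e v hb hε).and
          (eventually_le_of_mem_perturbation e v hb hε)))).exists
    have hbt : Bornology.IsBounded (polyhedron fun j => e j + t • v j) := by
      refine (hb.smul₀ (1 + ε)).subset fun p hp => ?_
      refine (Set.mem_smul_set_iff_inv_smul_mem₀ (by positivity) _ _).2 fun j => ?_
      rw [real_inner_smul_left, inv_mul_le_one₀ (by positivity)]
      exact hout p hp j
    have hσ : ∀ i, 0 < (1 + ε) * τ i := fun i => mul_pos (by positivity) (hτ i)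
    obtain ⟨c, hc⟩ := hgen _ (isGenericPolytope_polyhedron hd hbt hvt) n _ _ hσ hWt
    rw [← Finset.mul_sum, show lam * ((1 + ε) * ∑ i, τ i) = s * (1 + ε) by rw [hsdef]; ring] at hc
    refine ⟨c, fun i p hp j => ?_⟩
    have hsε : 0 < s * (1 + ε) := by positivity
    have hp1 : p ∈ homo (x i + τ i • z) ((1 + ε) * τ i) (polyhedron fun j => e j + t • v j) := by
      refine (mem_homo_polyhedron (hσ i)).2 fun k => ?_
      have hq : (τ i)⁻¹ • (p - (x i + τ i • z)) ∈ polyhedron e := fun k => by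
        rw [real_inner_smul_left, inv_mul_le_one₀ (hτ i)]
        exact (mem_homo_of_representation hPe (hτ i)).1 hp k
      have h1 := hin _ hq k
      rwa [real_inner_smul_left, inv_mul_le_iff₀ (hτ i), mul_comm] at h1
    have hp2 := hout _ ((mem_homo hsε).1 (hc (Set.mem_iUnion.2 ⟨i, hp1⟩))) j
    rw [real_inner_smul_left, inv_mul_le_iff₀ hsε] at hp2
    linarith
  choose! c hc using happrox
  set δ : ℕ → ℝ := fun k => 1 / ((k : ℝ) + 1) with hδ
  have hδ0 : ∀ k, 0 < δ k := fun k => Nat.one_div_pos_of_nat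
  have hδ1 : ∀ k, δ k ≤ 1 := fun k => by
    rw [hδ, div_le_one (by positivity)]
    linarith [(Nat.cast_nonneg k : (0 : ℝ) ≤ k)]
  obtain ⟨p₀, hp₀⟩ : (homo (x ⟨0, hn⟩) (τ ⟨0, hn⟩) P).Nonempty :=
    (Set.singleton_nonempty _).add hPne.smul_set
  have hK : IsCompact ((fun q => p₀ - q) '' ((4 * s) • polyhedron e)) :=
    ((isCompact_of_isClosed_isBounded isClosed_polyhedron hb).smul (4 * s)).image
      (continuous_sub_left p₀)
  have hcK : ∀ k, c (δ k) ∈ (fun q => p₀ - q) '' ((4 * s) • polyhedron e) := by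
    intro k
    refine ⟨p₀ - c (δ k), ?_, by simp⟩
    refine (Set.mem_smul_set_iff_inv_smul_mem₀ (by positivity) _ _).2 fun j => ?_
    rw [real_inner_smul_left, inv_mul_le_one₀ (by positivity)]
    refine (hc _ (hδ0 k) _ p₀ hp₀ j).trans ?_
    nlinarith [hδ0 k, hδ1 k, mul_le_mul_of_nonneg_left
      (show (1 + δ k) ^ 2 ≤ 4 by nlinarith [hδ0 k, hδ1 k]) hs.le]
  obtain ⟨c₀, -, φ, hφ, hlim⟩ := hK.tendsto_subseq hcK
  refine ⟨c₀ - s • z, Set.iUnion_subset fun i p hp => ?_⟩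
  refine (mem_homo_of_representation hPe hs).2 fun j => ?_
  rw [sub_add_cancel]
  have hδlim : Tendsto (fun k => s * (1 + δ (φ k)) ^ 2) atTop (𝓝 s) := by
    have h := (tendsto_one_div_add_atTop_nhds_zero_nat (𝕜 := ℝ)).comp hφ.tendsto_atTop
    simpa [hδ] using ((h.const_add 1).pow 2).const_mul s
  have hleft : Tendsto (fun k => inner ℝ (p - c (δ (φ k))) (e j)) atTop
      (𝓝 (inner ℝ (p - c₀) (e j))) :=
    (hlim.const_sub p).inner tendsto_const_nhds
  exact le_of_tendsto_of_tendsto' hleft hδlim fun k => hc _ (hδ0 _) i p hp j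

end
end

section
/- Let d ≥ 2 and n ≥ 2, let P be a d-polytope in ℝ^d, and let 𝒫 = {xᵢ + τᵢP : xᵢ ∈ ℝ^d, τᵢ > 0, i = 1, …, n} be a weakly non-separable family of positive homothets of P. Then some translate of ((d+1)/2)·(Σᵢ₌₁ⁿ τᵢ)·P contains ⋃𝒫. -/
open Set Metric Pointwise MeasureTheory

noncomputable section

variable {d : ℕ}

/-- In a finite family of intervals with right endpoints `b i` and lengths `w * τ i`, each of which
not ending at the maximum `b m` is prolonged by another one, the distance from `b i` to `b m` is at
most the total length of the intervals ending after `b i`. -/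
lemma sub_le_sum_of_prolonged {ι : Type*} [Fintype ι] {b τ : ι → ℝ} {w : ℝ} {m : ι}
    (hτ : ∀ i, 0 ≤ τ i) (hw : 0 ≤ w)
    (hstep : ∀ i, b i < b m → ∃ j, b j - w * τ j ≤ b i ∧ b i < b j) (i : ι) :
    b m - b i ≤ w * ∑ j with b i < b j, τ j := by
  classical
  induction hk : (Finset.univ.filter fun j => b i < b j).card using Nat.strong_induction_on
    generalizing i with
  | _ k ih =>
    have hnonneg : 0 ≤ w * ∑ j with b i < b j, τ j :=
      mul_nonneg hw (Finset.sum_nonneg fun j _ => hτ j)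
    by_cases hi : b i < b m
    · obtain ⟨j, hj₁, hj₂⟩ := hstep i hi
      have hjmem : j ∉ Finset.univ.filter fun k => b j < b k := by simp
      have hsub : insert j (Finset.univ.filter fun k => b j < b k) ⊆
          Finset.univ.filter fun k => b i < b k := by
        intro k hk
        simp only [Finset.mem_insert, Finset.mem_filter, Finset.mem_univ, true_and] at hk ⊢
        rcases hk with rfl | hk
        · exact hj₂
        · exact hj₂.trans hk
      have hcard := Finset.card_le_card hsub
      rw [Finset.card_insert_of_notMem hjmem] at hcard
      have hrec := ih _ (by omega) j rfl
      have hsum := Finset.sum_le_sum_of_subset_of_nonneg hsub fun k _ _ => hτ k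
      rw [Finset.sum_insert hjmem] at hsum
      nlinarith [mul_le_mul_of_nonneg_left hsum hw]
    · linarith

/-- The interval of length `w * ∑ i, τ i` centred at the weighted mean of the centres of a family of
intervals of lengths `w * τ i` reaches to the right of the whole family. -/
lemma sum_mul_sub_add_le_of_prolonged {ι : Type*} [Fintype ι] {b τ : ι → ℝ} {w : ℝ} {m : ι}
    (hτ : ∀ i, 0 ≤ τ i) (hw : 0 ≤ w)
    (hstep : ∀ i, b i < b m → ∃ j, b j - w * τ j ≤ b i ∧ b i < b j) :
    ∑ i, τ i * (b m - b i + w * τ i / 2) ≤ w * (∑ i, τ i) ^ 2 / 2 := by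
  classical
  have hpair : ∑ i, ∑ j, (if b i < b j then τ i * τ j else 0) =
      ∑ i, ∑ j, (if b j < b i then τ i * τ j else 0) := by
    rw [Finset.sum_comm]
    simp only [mul_comm]
  have hdiag : ∑ i, ∑ j, (if i = j then τ i * τ j else 0) = ∑ i, τ i ^ 2 := by
    simp [sq]
  have htotal : ∑ i, ∑ j, (if b i < b j then τ i * τ j else 0) +
      ∑ i, ∑ j, (if b j < b i then τ i * τ j else 0) +
      ∑ i, ∑ j, (if i = j then τ i * τ j else 0) ≤ (∑ i, τ i) ^ 2 := by
    rw [sq, Finset.sum_mul_sum]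
    simp only [← Finset.sum_add_distrib]
    refine Finset.sum_le_sum fun i _ => Finset.sum_le_sum fun j _ => ?_
    have := mul_nonneg (hτ i) (hτ j)
    rcases lt_trichotomy (b i) (b j) with h | h | h
    · have hij : i ≠ j := by rintro rfl; exact lt_irrefl _ h
      simp [h, h.not_gt, hij]
    · split_ifs <;> linarith
    · have hij : i ≠ j := by rintro rfl; exact lt_irrefl _ h
      simp [h, h.not_gt, hij]
  have hterm : ∑ i, τ i * (b m - b i + w * τ i / 2) ≤
      w * ∑ i, ∑ j, (if b i < b j then τ i * τ j else 0) + w / 2 * ∑ i, τ i ^ 2 := by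
    rw [Finset.mul_sum, Finset.mul_sum, ← Finset.sum_add_distrib]
    refine Finset.sum_le_sum fun i _ => ?_
    have h := mul_le_mul_of_nonneg_left (sub_le_sum_of_prolonged hτ hw hstep i) (hτ i)
    have hsum : ∑ j, (if b i < b j then τ i * τ j else 0) = τ i * ∑ j with b i < b j, τ j := by
      rw [Finset.mul_sum, Finset.sum_filter]
    rw [hsum]
    linarith
  nlinarith [mul_le_mul_of_nonneg_left htotal hw]

/-- A finite family of closed intervals `[a i, b i]` covering everything between any two right
endpoints contains, for each `i` with `b i` not maximal, an interval prolonging `[a i, b i]`. -/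
lemma exists_prolonging_of_cover {ι : Type*} [Fintype ι] {a b : ι → ℝ} {m : ι}
    (hab : ∀ i, a i ≤ b i) {i : ι} (hi : b i < b m)
    (hcover : ∀ t, b i ≤ t → t ≤ b m → ∃ j, a j ≤ t ∧ t ≤ b j) :
    ∃ j, a j ≤ b i ∧ b i < b j := by
  classical
  by_contra! hcon
  have hmem : m ∈ Finset.univ.filter fun j => b i < b j := by simpa using hi
  obtain ⟨k, hk, hmin⟩ := Finset.exists_min_image _ a ⟨m, hmem⟩
  simp only [Finset.mem_filter, Finset.mem_univ, true_and] at hk hmin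
  have hik : b i < a k := by
    by_contra! h
    exact (hcon k h).not_gt hk
  have hkm : a k ≤ b m := (hmin m hi).trans (hab m)
  obtain ⟨j, hj₁, hj₂⟩ := hcover ((b i + a k) / 2) (by linarith) (by linarith)
  have := hmin j (by linarith)
  linarith

/-- Every compact convex set contains a point `g` with `K - g ⊆ -d (K - g)`. -/
lemma exists_minkowski_center {K : Set (Euc d)} (hK : IsCompact K) (hconv : Convex ℝ K)
    (hne : K.Nonempty) :
    ∃ g ∈ K, ∀ p ∈ K, ∃ r ∈ K, ((d : ℝ) + 1) • g = (d : ℝ) • r + p := by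
  classical
  have hd : (0 : ℝ) < (d : ℝ) + 1 := by positivity
  let F : K → Set (Euc d) := fun p => (fun r => ((d : ℝ) + 1)⁻¹ • ((d : ℝ) • r + (p : Euc d))) '' K
  have hFconv : ∀ p, Convex ℝ (F p) := by
    intro p
    have h : F p = ((d : ℝ) + 1)⁻¹ • ((fun z => (p : Euc d) + z) '' ((d : ℝ) • K)) := by
      simp only [F, ← image_smul, image_image, add_comm]
    rw [h]
    exact ((hconv.smul _).translate _).smul _
  have hFcomp : ∀ p, IsCompact (F p) := fun p => hK.image (by fun_prop)
  have hinter : (⋂ p, F p).Nonempty := by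
    refine Convex.helly_theorem_compact' hFconv hFcomp fun I hI => ?_
    rw [finrank_euclideanSpace_fin] at hI
    obtain ⟨q, hq⟩ := hne
    let s : Euc d := ∑ p ∈ I, (p : Euc d) + ((d : ℝ) + 1 - I.card) • q
    refine ⟨((d : ℝ) + 1)⁻¹ • s, mem_iInter₂.2 fun p hp => ?_⟩
    have hcard : 1 ≤ I.card := Finset.card_pos.2 ⟨p, hp⟩
    have hI' : (I.card : ℝ) ≤ (d : ℝ) + 1 := by exact_mod_cast hI
    rcases Nat.eq_zero_or_pos d with hd0 | hd0
    · subst hd0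
      exact ⟨q, hq, Subsingleton.elim _ _⟩
    have hdpos : (0 : ℝ) < d := by exact_mod_cast hd0
    have hsum : ∑ p ∈ I, (p : Euc d) = ∑ p ∈ I.erase p, (p : Euc d) + p :=
      (Finset.sum_erase_add _ _ hp).symm
    have hr : (d : ℝ)⁻¹ • (s - p) ∈ K := by
      have hmem : ∑ o ∈ Finset.insertNone (I.erase p),
          (o.elim ((d : ℝ)⁻¹ * ((d : ℝ) + 1 - I.card)) fun _ => (d : ℝ)⁻¹) •
            (o.elim q fun p : K => (p : Euc d)) ∈ K := by
        refine hconv.sum_mem ?_ ?_ ?_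
        · rintro (_ | o) -
          · exact mul_nonneg (inv_nonneg.2 hdpos.le) (by linarith)
          · exact inv_nonneg.2 hdpos.le
        · rw [Finset.sum_insertNone]
          simp only [Option.elim, Finset.sum_const, Finset.card_erase_of_mem hp, nsmul_eq_mul,
            Nat.cast_sub hcard]
          field_simp
          push_cast
          ring
        · rintro (_ | o) -
          · exact hq
          · exact o.2
      rw [Finset.sum_insertNone] at hmem
      simp only [Option.elim] at hmem
      rw [← Finset.smul_sum, mul_smul, ← smul_add] at hmem
      convert hmem using 2
      simp only [s, hsum]
      abel
    refine ⟨_, hr, ?_⟩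
    simp only
    rw [smul_inv_smul₀ hdpos.ne', sub_add_cancel]
  obtain ⟨g, hg⟩ := hinter
  rw [mem_iInter] at hg
  have hrep : ∀ p ∈ K, ∃ r ∈ K, ((d : ℝ) + 1) • g = (d : ℝ) • r + p := by
    intro p hp
    obtain ⟨r, hr, hrg⟩ := hg ⟨p, hp⟩
    refine ⟨r, hr, ?_⟩
    rw [← hrg]
    exact smul_inv_smul₀ hd.ne' _
  refine ⟨g, ?_, hrep⟩
  obtain ⟨p, hp⟩ := hne
  obtain ⟨r, hr, hrg⟩ := hg ⟨p, hp⟩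
  have := hconv hr hp (a := ((d : ℝ) + 1)⁻¹ * d) (b := ((d : ℝ) + 1)⁻¹) (by positivity)
    (by positivity) (by field_simp)
  rw [mul_smul, ← smul_add] at this
  exact hrg ▸ this

/-- The points of the convex hull of `S` maximizing a linear functional lie in the convex hull of the
points of `S` maximizing it. -/
lemma mem_convexHull_filter_of_forall_inner_le {S : Finset (Euc d)} {u z : Euc d}
    (hz : z ∈ convexHull ℝ (S : Set (Euc d))) (hmax : ∀ p ∈ S, inner ℝ p u ≤ inner ℝ z u) :
    z ∈ convexHull ℝ {p | p ∈ S ∧ inner ℝ p u = inner ℝ z u} := by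
  obtain ⟨w, hw₀, hw₁, hwz⟩ := Finset.mem_convexHull'.1 hz
  have hsum : ∑ p ∈ S, w p * (inner ℝ z u - inner ℝ p u) = 0 := by
    simp only [mul_sub, Finset.sum_sub_distrib, ← Finset.sum_mul, hw₁, one_mul]
    nth_rewrite 1 [← hwz]
    simp [sum_inner, inner_smul_left]
  have hzero := (Finset.sum_eq_zero_iff_of_nonneg fun p hp =>
    mul_nonneg (hw₀ p hp) (sub_nonneg.2 (hmax p hp))).1 hsum
  classical
  have hvanish : ∀ p ∈ S, ¬ inner ℝ p u = inner ℝ z u → w p = 0 := by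
    intro p hp hne
    rcases mul_eq_zero.1 (hzero p hp) with h | h
    · exact h
    · exact absurd (by linarith) hne
  have hset : {p | p ∈ S ∧ inner ℝ p u = inner ℝ z u} =
      ((S.filter fun p => inner ℝ p u = inner ℝ z u : Finset (Euc d)) : Set (Euc d)) := by
    ext; simp
  rw [hset]
  refine Finset.mem_convexHull'.2 ⟨w, fun p hp => hw₀ p (Finset.mem_filter.1 hp).1, ?_, ?_⟩
  · rw [← hw₁]
    refine Finset.sum_subset (Finset.filter_subset _ _) fun p hp hp' => hvanish p hp ?_
    simpa [hp] using hp'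
  · refine Eq.trans ?_ hwz
    refine Finset.sum_subset (Finset.filter_subset _ _) fun p hp hp' => ?_
    rw [hvanish p hp (by simpa [hp] using hp'), zero_smul]

/-- A nonempty open set contains a point outside of finitely many proper affine subspaces. -/
lemma exists_mem_forall_notMem_affineSubspace {U : Set (Euc d)} (hU : IsOpen U) (hne : U.Nonempty)
    {ι : Type*} [Finite ι] (A : ι → AffineSubspace ℝ (Euc d)) :
    ∃ o ∈ U, ∀ i, A i ≠ ⊤ → o ∉ A i := by
  by_contra! hcon
  have hnull : volume (⋃ i : {i // A i ≠ ⊤}, (A i : Set (Euc d))) = 0 :=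
    measure_iUnion_null fun i => Measure.addHaar_affineSubspace _ _ i.2
  have hsub : U ⊆ ⋃ i : {i // A i ≠ ⊤}, (A i : Set (Euc d)) := by
    intro o ho
    obtain ⟨i, hi, hoi⟩ := hcon o ho
    exact mem_iUnion.2 ⟨⟨i, hi⟩, hoi⟩
  exact (hU.measure_pos volume hne).ne' (measure_mono_null hsub hnull)

/-- A polytope is the intersection of its facet half-spaces. -/
lemma mem_of_forall_facetNormal (hd : 1 ≤ d) {P : Set (Euc d)} (hP : IsPolytope P) {y : Euc d}
    (hy : ∀ u, IsFacetNormal P u → ∃ p ∈ P, inner ℝ y u ≤ inner ℝ p u) : y ∈ P := by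
  classical
  obtain ⟨S, hPS, hint⟩ := hP
  by_contra hyP
  have hconv : Convex ℝ P := hPS ▸ convex_convexHull ℝ _
  have hclosed : IsClosed P := hPS ▸ S.finite_toSet.isClosed_convexHull ℝ
  obtain ⟨o, ho, hgen⟩ := exists_mem_forall_notMem_affineSubspace isOpen_interior hint
    fun T : S.powerset => affineSpan ℝ (insert y ((T : Finset (Euc d)) : Set (Euc d)))
  obtain ⟨z, hzseg, hzfr⟩ : (segment ℝ o y ∩ frontier P).Nonempty := by
    by_contra hempty
    rw [not_nonempty_iff_eq_empty] at hempty
    have hpre := (convex_segment (𝕜 := ℝ) o y).isPreconnected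
    obtain ⟨q, -, hq₁, hq₂⟩ := hpre (interior P) Pᶜ isOpen_interior hclosed.isOpen_compl
      (fun q hq => by
        by_cases hqP : q ∈ P
        · left
          by_contra hqi
          have : q ∈ segment ℝ o y ∩ frontier P := ⟨hq, subset_closure hqP, hqi⟩
          simp [hempty] at this
        · exact Or.inr hqP)
      ⟨o, left_mem_segment ℝ o y, ho⟩ ⟨y, right_mem_segment ℝ o y, hyP⟩
    exact hq₂ (interior_subset hq₁)
  have hzP : z ∈ P := hclosed.frontier_subset hzfr
  obtain ⟨f, hf⟩ := geometric_hahn_banach_open_point hconv.interior isOpen_interior hzfr.2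
  obtain ⟨v, rfl⟩ := (InnerProductSpace.toDual ℝ (Euc d)).surjective f
  simp only [InnerProductSpace.toDual_apply_apply] at hf
  have hv : v ≠ 0 := by
    rintro rfl
    simpa using hf o ho
  have hvpos : 0 < ‖v‖⁻¹ := inv_pos.2 (norm_pos_iff.2 hv)
  set u : Euc d := ‖v‖⁻¹ • v with hu
  have hunorm : ‖u‖ = 1 := norm_smul_inv_norm hv
  have hinner : ∀ p : Euc d, inner ℝ p u = ‖v‖⁻¹ * inner ℝ v p := by
    intro p
    rw [hu, inner_smul_right, real_inner_comm]
  have hou : inner ℝ o u < inner ℝ z u := by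
    rw [hinner, hinner]
    exact mul_lt_mul_of_pos_left (hf o ho) hvpos
  have hmax : ∀ p ∈ P, inner ℝ p u ≤ inner ℝ z u := by
    have hsub : closure (interior P) ⊆ {p | inner ℝ p u ≤ inner ℝ z u} := by
      refine closure_minimal (fun p hp => ?_) (isClosed_le (by fun_prop) continuous_const)
      simp only [mem_ofPred_eq]
      rw [hinner, hinner]
      exact (mul_lt_mul_of_pos_left (hf p hp) hvpos).le
    rw [hconv.closure_interior_eq_closure_of_nonempty_interior hint] at hsub
    exact fun p hp => hsub (subset_closure hp)
  obtain ⟨s, t, hs, ht, hst, hz⟩ := hzseg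
  have ht0 : t ≠ 0 := by
    rintro rfl
    have hs1 : s = 1 := by linarith
    subst hs1
    simp only [one_smul, zero_smul, add_zero] at hz
    exact hzfr.2 (hz ▸ ho)
  have hs0 : s ≠ 0 := by
    rintro rfl
    have ht1 : t = 1 := by linarith
    subst ht1
    simp only [one_smul, zero_smul, zero_add] at hz
    exact hyP (hz ▸ hzP)
  have hzinner : inner ℝ z u = s * inner ℝ o u + t * inner ℝ y u := by
    rw [← hz, inner_add_left, inner_smul_left, inner_smul_left]
    simp
  have hyu : inner ℝ z u < inner ℝ y u := by
    have hspos : 0 < s := lt_of_le_of_ne hs hs0.symm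
    have htpos : 0 < t := lt_of_le_of_ne ht ht0.symm
    have hs' : s = 1 - t := by linarith
    by_contra! hcon
    have := mul_lt_mul_of_pos_left hou hspos
    have := mul_le_mul_of_nonneg_left hcon ht
    subst hs'
    linarith
  have hfacet : IsFacetNormal P u := by
    refine ⟨hunorm, le_antisymm ?_ ?_⟩
    · have hle : (affineSpan ℝ (exposedFaceAt P u)).direction ≤ (ℝ ∙ u)ᗮ := by
        rw [direction_affineSpan, vectorSpan_def, Submodule.span_le]
        rintro _ ⟨p, hp, q, hq, rfl⟩
        simp only [SetLike.mem_coe, Submodule.mem_orthogonal_singleton_iff_inner_left, vsub_eq_sub,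
          inner_sub_left, sub_eq_zero]
        exact le_antisymm (hq.2 p hp.1) (hp.2 q hq.1)
      refine (Submodule.finrank_mono hle).trans ?_
      have h₁ := (ℝ ∙ u).finrank_add_finrank_orthogonal
      rw [finrank_span_singleton (by rintro h; simp [h] at hunorm), finrank_euclideanSpace_fin]
        at h₁
      omega
    · by_contra! hlt
      let T : Finset (Euc d) := S.filter fun p => inner ℝ p u = inner ℝ z u
      have hTS : T ∈ S.powerset := Finset.mem_powerset.2 (Finset.filter_subset _ _)
      have hTface : (T : Set (Euc d)) ⊆ exposedFaceAt P u := by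
        intro p hp
        obtain ⟨hpS, hpz⟩ := Finset.mem_filter.1 (Finset.mem_coe.1 hp)
        refine ⟨hPS ▸ subset_convexHull ℝ _ hpS, fun q hq => ?_⟩
        rw [hpz]
        exact hmax q hq
      have hzT : z ∈ affineSpan ℝ (insert y (T : Set (Euc d))) := by
        have h := mem_convexHull_filter_of_forall_inner_le (hPS ▸ hzP)
          fun p hp => hmax p (hPS ▸ subset_convexHull ℝ _ hp)
        refine affineSpan_mono ℝ ?_ (convexHull_subset_affineSpan _ h)
        intro p hp
        exact mem_insert_of_mem _ (by simpa [T] using hp)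
      have hyT : y ∈ affineSpan ℝ (insert y (T : Set (Euc d))) :=
        subset_affineSpan ℝ _ (mem_insert _ _)
      refine hgen ⟨T, hTS⟩ ?_ ?_
      · intro htop
        have h₁ := finrank_vectorSpan_insert_le_set ℝ (T : Set (Euc d)) y
        have h₂ := Submodule.finrank_mono (vectorSpan_mono ℝ hTface)
        rw [← direction_affineSpan, htop, AffineSubspace.direction_top, finrank_top,
          finrank_euclideanSpace_fin] at h₁
        rw [direction_affineSpan] at hlt
        omega
      · have ho' : o = AffineMap.lineMap y z s⁻¹ := by
          rw [AffineMap.lineMap_apply_module, ← hz, smul_add, smul_smul, smul_smul,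
            inv_mul_cancel₀ hs0, one_smul, add_left_comm, ← add_smul]
          have hcoef : 1 - s⁻¹ + s⁻¹ * t = 0 := by
            field_simp
            linarith
          rw [hcoef, zero_smul, add_zero]
        rw [ho']
        exact AffineMap.lineMap_mem _ hyT hzT
  obtain ⟨p, hp, hyp⟩ := hy u hfacet
  exact absurd (hmax p hp) (by linarith)

/-- Hyperplanes orthogonal to a facet normal and meeting the convex hull of a weakly non-separable
family meet one of its members. -/
lemma WNS.exists_inner_eq {P : Set (Euc d)} {n : ℕ} {x : Fin n → Euc d} {τ : Fin n → ℝ}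
    (hWNS : WNS P x τ) {u q : Euc d} (hu : IsFacetNormal P u) (hq : q ∈ P)
    (hmax : ∀ p ∈ P, inner ℝ p u ≤ inner ℝ q u) {i m : Fin n} {t : ℝ}
    (hi : inner ℝ (x i) u + τ i * inner ℝ q u ≤ t)
    (hm : t ≤ inner ℝ (x m) u + τ m * inner ℝ q u) :
    ∃ j, ∃ p ∈ P, inner ℝ (x j) u + τ j * inner ℝ p u = t := by
  have huu : inner ℝ u u = (1 : ℝ) := by rw [real_inner_self_eq_norm_sq, hu.1]; norm_num
  have hu0 : u ≠ 0 := by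
    rintro rfl
    simp at huu
  have hmem : ∀ k, x k + τ k • q ∈ convexHull ℝ (⋃ i, homo (x i) (τ i) P) := fun k =>
    subset_convexHull ℝ _ (mem_iUnion.2 ⟨k, add_mem_add rfl (smul_mem_smul_set hq)⟩)
  have hval : ∀ (k : Fin n) (p : Euc d),
      inner ℝ (x k + τ k • p) u = inner ℝ (x k) u + τ k * inner ℝ p u := by
    intro k p
    rw [inner_add_left, inner_smul_left]
    simp
  obtain ⟨z, hz, hzt⟩ : t ∈ (fun z : Euc d => (inner ℝ z u : ℝ)) ''
      convexHull ℝ (⋃ i, homo (x i) (τ i) P) := by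
    refine ((convex_convexHull ℝ _).isPreconnected.image _ (by fun_prop)).ordConnected.out
      ⟨_, hmem i, rfl⟩ ⟨_, hmem m, rfl⟩ ⟨?_, ?_⟩
    · simpa only [hval] using hi
    · simpa only [hval] using hm
  have hpar : HypParallelToFacet P {y | inner ℝ y u = t} := by
    refine ⟨u, hu, (inner ℝ q u - t) • u, fun p hp => ⟨p - (inner ℝ q u - t) • u, ?_, by simp⟩⟩
    have hpq : inner ℝ p u = inner ℝ q u := le_antisymm (hmax p hp.1) (hp.2 q hq)
    simp only [mem_ofPred_eq]
    rw [inner_sub_left, real_inner_smul_left, huu, hpq]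
    ring
  obtain ⟨j, y, hyH, hy⟩ := hWNS _ ⟨u, hu0, t, rfl⟩ hpar ⟨z, hzt, hz⟩
  obtain ⟨_, rfl, _, ⟨p, hp, rfl⟩, rfl⟩ := hy
  refine ⟨j, p, hp, ?_⟩
  rw [← hval]
  exact hyH

/-- a translate of `((d+1)/2)(∑τᵢ)P` covers any WNS-family of
positive homothets of a d-polytope `P`. -/
theorem stmt_9 (d n : ℕ) (hd : 2 ≤ d) (hn : 2 ≤ n)
    (P : Set (Euc d)) (hP : IsPolytope P)
    (x : Fin n → Euc d) (τ : Fin n → ℝ) (hτ : ∀ i, 0 < τ i)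
    (hWNS : WNS P x τ) :
    ∃ c : Euc d, (⋃ i, homo (x i) (τ i) P) ⊆
      homo c (((d : ℝ) + 1) / 2 * ∑ i, τ i) P := by
  obtain ⟨S, hPS, hint⟩ := id hP
  have hconv : Convex ℝ P := hPS ▸ convex_convexHull ℝ _
  have hcomp : IsCompact P := hPS ▸ S.finite_toSet.isCompact_convexHull ℝ
  have hne : P.Nonempty := hint.mono interior_subset
  obtain ⟨g, hgP, hg⟩ := exists_minkowski_center hcomp hconv hne
  have : Nonempty (Fin n) := ⟨⟨0, by omega⟩⟩
  set T : ℝ := ∑ i, τ i with hT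
  have hTpos : 0 < T := Finset.sum_pos (fun i _ => hτ i) Finset.univ_nonempty
  set lam : ℝ := ((d : ℝ) + 1) / 2 * T with hlam
  have hlampos : 0 < lam := by positivity
  have hd' : (2 : ℝ) ≤ d := by exact_mod_cast hd
  set c : Euc d := T⁻¹ • ∑ i, τ i • (x i + τ i • g) - lam • g with hc
  refine ⟨c, iUnion_subset fun k => ?_⟩
  rintro _ ⟨_, rfl, _, ⟨p, hp, rfl⟩, rfl⟩
  refine ⟨c, rfl, x k + τ k • p - c, ?_, by simp⟩
  rw [mem_smul_set_iff_inv_smul_mem₀ hlampos.ne']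
  refine mem_of_forall_facetNormal (by omega) hP fun u hu => ?_
  have hcont : ContinuousOn (fun z : Euc d => (inner ℝ z u : ℝ)) P := by fun_prop
  obtain ⟨q, hq, hmax⟩ := hcomp.exists_isMaxOn hne hcont
  obtain ⟨r, hr, hmin⟩ := hcomp.exists_isMinOn hne hcont
  rw [isMaxOn_iff] at hmax
  rw [isMinOn_iff] at hmin
  refine ⟨q, hq, ?_⟩
  set α : ℝ := inner ℝ r u
  set β : ℝ := inner ℝ q u
  set γ : ℝ := inner ℝ g u
  have hγβ : γ ≤ β := hmax g hgP
  have hαβ : α ≤ β := hmin q hq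
  have hasym : γ - α ≤ d * (β - γ) := by
    obtain ⟨r', hr', h⟩ := hg r hr
    have h' := congrArg (fun z : Euc d => (inner ℝ z u : ℝ)) h
    simp only [inner_add_left, real_inner_smul_left] at h'
    have := mul_le_mul_of_nonneg_left (hmax r' hr') (by linarith : (0 : ℝ) ≤ d)
    linarith
  let b : Fin n → ℝ := fun i => inner ℝ (x i) u + τ i * β
  obtain ⟨m, -, hm⟩ := Finset.exists_max_image Finset.univ b Finset.univ_nonempty
  have hkey : ∑ i, τ i * (b m - b i + (β - α) * τ i / 2) ≤ (β - α) * T ^ 2 / 2 := by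
    refine sum_mul_sub_add_le_of_prolonged (fun i => (hτ i).le) (by linarith) fun i hi => ?_
    refine exists_prolonging_of_cover (a := fun j => b j - (β - α) * τ j) (m := m)
      (fun j => ?_) hi fun t hti htm => ?_
    · have := mul_nonneg (sub_nonneg.2 hαβ) (hτ j).le
      linarith
    · obtain ⟨j, p', hp', hj⟩ := hWNS.exists_inner_eq hu hq hmax hti htm
      have h₁ := mul_le_mul_of_nonneg_left (hmax p' hp') (hτ j).le
      have h₂ := mul_le_mul_of_nonneg_left (hmin p' hp') (hτ j).le
      exact ⟨j, by simp only [b]; linarith, by simp only [b]; linarith⟩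
  set Q : ℝ := ∑ i, τ i ^ 2 with hQ
  set X : ℝ := ∑ i, τ i * inner ℝ (x i) u with hX
  have hexpand : ∑ i, τ i * (b m - b i + (β - α) * τ i / 2) =
      T * b m - X - (α + β) / 2 * Q := by
    rw [hT, hX, hQ, Finset.sum_mul, Finset.mul_sum, ← Finset.sum_sub_distrib,
      ← Finset.sum_sub_distrib]
    refine Finset.sum_congr rfl fun i _ => ?_
    simp only [b]
    ring
  have hcu : inner ℝ c u = T⁻¹ * (X + γ * Q) - lam * γ := by
    rw [hc, inner_sub_left, real_inner_smul_left, real_inner_smul_left, sum_inner, hX, hQ,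
      Finset.mul_sum (a := γ), ← Finset.sum_add_distrib]
    congr 2
    refine Finset.sum_congr rfl fun i _ => ?_
    rw [real_inner_smul_left, inner_add_left, real_inner_smul_left]
    ring
  have hQ0 : 0 ≤ Q := Finset.sum_nonneg fun i _ => sq_nonneg _
  have hQT : Q ≤ T ^ 2 := Finset.sum_sq_le_sq_sum_of_nonneg fun i _ => (hτ i).le
  have hbm : b m ≤ T⁻¹ * (X + γ * Q) - lam * γ + lam * β := by
    have h₁ := mul_le_mul_of_nonneg_right hasym (sub_nonneg.2 hQT)
    have h₂ : 0 ≤ (d - 1 : ℝ) * ((β - γ) * Q) :=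
      mul_nonneg (by linarith) (mul_nonneg (sub_nonneg.2 hγβ) hQ0)
    have h₃ : T * b m ≤ X + γ * Q + T * lam * (β - γ) := by
      rw [hlam]
      nlinarith
    have h₄ : T * (T⁻¹ * (X + γ * Q) - lam * γ + lam * β) = X + γ * Q + T * lam * (β - γ) := by
      field_simp
      ring
    exact le_of_mul_le_mul_left (h₃.trans_eq h₄.symm) hTpos
  have hpb : inner ℝ (x k) u + τ k * inner ℝ p u ≤ b m :=
    (add_le_add_right (mul_le_mul_of_nonneg_left (hmax p hp) (hτ k).le) _).trans
      (hm k (Finset.mem_univ k))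
  rw [real_inner_smul_left, inv_mul_le_iff₀ hlampos, inner_sub_left, inner_add_left,
    real_inner_smul_left, hcu]
  linarith

end
end
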